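/- arXiv:1609.07076 — 2 statements merged into one kernel-verified Lean document; each statement's English description precedes it below -/
import Mathlib

section
/- For all nonzero integers M and all integers N ≥ N_1, one has 1 < |e^{s/t} − M/N| · Z(N) · N^{2 + 2·log(|s|/α)·z(σ·log N)/(σ·log N)}, where N_1 is determined by log N_1 = max{(η−β)·log(σ(η−β)), log(gcd(2,s)/|4s + 2(s−2t)(e^{s/t}−1)|)}. -/
open Real Finset

/-- `α = ∏_{p prime, p ∣ s} p^(1/(p-1))`. -/
noncomputable def alphaS (s : ℤ) : ℝ :=
  ∏ p ∈ s.natAbs.primeFactors, (p : ℝ) ^ ((1 : ℝ) / ((p : ℝ) - 1))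

/-- `β` = number of odd primes dividing `s`. -/
def betaS (s : ℤ) : ℕ := (s.natAbs.primeFactors.erase 2).card

/-- `γ` = product of the odd primes dividing `s`. -/
def gammaS (s : ℤ) : ℕ := ∏ p ∈ s.natAbs.primeFactors.erase 2, p

/-- `z(y)`: the inverse function of `y(z) = z log z`, `z ≥ 1/e`. -/
noncomputable def zFun (y : ℝ) : ℝ :=
  Function.invFunOn (fun x : ℝ => x * Real.log x) (Set.Ici (Real.exp (-1))) y

/-- `σ = 4tα/(e s²)`. -/
noncomputable def sigmaS (s t : ℤ) : ℝ :=
  4 * (t : ℝ) * alphaS s / (Real.exp 1 * (s : ℝ) ^ 2)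

/-- `ζ(N) = z(σ log N)/σ + β`. -/
noncomputable def zetaS (s t : ℤ) (N : ℝ) : ℝ :=
  zFun (sigmaS s t * Real.log N) / sigmaS s t + (betaS s : ℝ)

/-- `Z(N)`. -/
noncomputable def ZS (s t : ℤ) (N : ℝ) : ℝ :=
  ((s : ℝ) ^ 2 / (alphaS s) ^ 2 * (zetaS s t N + 1)) ^ (betaS s) *
    (8 * (gammaS s : ℝ) ^ 2 * |(s : ℝ)| * (4 * (t : ℝ) * zetaS s t N + 6 * (t : ℝ) + (s : ℝ) ^ 2)
        * (zetaS s t N) ^ (betaS s) / alphaS s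
      + (Int.gcd 2 s : ℝ) * (alphaS s) ^ 2 * (gammaS s : ℝ)
        / (N ^ 2 * (s : ℝ) ^ 2 * |Real.exp ((s : ℝ) / (t : ℝ)) - 1|))

/-- `η = max{√e |e^{s/t}-1| γ/(√2 σ^β) - 1/2, e/σ + β}`. -/
noncomputable def etaS (s t : ℤ) : ℝ :=
  max (Real.sqrt (Real.exp 1) * |Real.exp ((s : ℝ) / (t : ℝ)) - 1| * (gammaS s : ℝ)
        / (Real.sqrt 2 * sigmaS s t ^ (betaS s)) - 1 / 2)
      (Real.exp 1 / sigmaS s t + (betaS s : ℝ))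

/-- `log N₁ = max{(η-β) log(σ(η-β)), log(gcd(2,s)/|4s + 2(s-2t)(e^{s/t}-1)|)}`. -/
noncomputable def logN1 (s t : ℤ) : ℝ :=
  max ((etaS s t - (betaS s : ℝ)) * Real.log (sigmaS s t * (etaS s t - (betaS s : ℝ))))
      (Real.log ((Int.gcd 2 s : ℝ)
        / |4 * (s : ℝ) + 2 * ((s : ℝ) - 2 * (t : ℝ)) * (Real.exp ((s : ℝ) / (t : ℝ)) - 1)|))



/-- coefficient -/
noncomputable def hCoef (n j : ℕ) : ℝ := ((n+j).factorial : ℝ) / (j.factorial * (2*n+2*j).factorial)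

lemma hCoef_pos (n j : ℕ) : 0 < hCoef n j := by unfold hCoef; positivity

lemma hCoef_step (n j : ℕ) : hCoef n j = 2*(2*n+2*j+1) * hCoef (n+1) j := by
  unfold hCoef
  have e1 : n+1+j = (n+j)+1 := by ring
  have e2 : 2*(n+1)+2*j = (2*n+2*j)+1+1 := by ring
  rw [e1, e2, Nat.factorial_succ, Nat.factorial_succ, Nat.factorial_succ]
  have := Nat.factorial_pos (n+j)
  have := Nat.factorial_pos j
  have := Nat.factorial_pos (2*n+2*j)
  push_cast
  field_simp
  ring

lemma hCoef_shift (n j : ℕ) : (j+1 : ℝ) * hCoef (n+1) (j+1) = hCoef (n+2) j := by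
  unfold hCoef
  have e1 : n+1+(j+1) = n+2+j := by ring
  have e2 : 2*(n+1)+2*(j+1) = 2*(n+2)+2*j := by ring
  rw [e1, e2, Nat.factorial_succ j]
  push_cast
  field_simp

lemma hCoef_summable (w : ℝ) (n : ℕ) : Summable fun j => hCoef n j * w^(2*j) := by
  induction n with
  | zero =>
    refine (Real.hasSum_cosh w).summable.congr fun j => ?_
    unfold hCoef
    have := Nat.factorial_pos j
    simp only [Nat.zero_add, Nat.mul_zero]
    field_simp
  | succ n ih =>
    refine Summable.of_nonneg_of_le (fun j => ?_) (fun j => ?_) ih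
    · have := hCoef_pos (n+1) j
      have : 0 ≤ w^(2*j) := by rw [pow_mul]; positivity
      positivity
    · have h0 : 0 ≤ w^(2*j) := by rw [pow_mul]; positivity
      apply mul_le_mul_of_nonneg_right _ h0
      have := hCoef_pos (n+1) j
      rw [hCoef_step n j]
      have : (1:ℝ) ≤ 2*(2*n+2*j+1) := by
        have : (0:ℝ) ≤ n := by positivity
        have : (0:ℝ) ≤ j := by positivity
        linarith
      nlinarith

lemma exists_H (w : ℝ) : ∃ H : ℕ → ℝ, (∀ n, 0 < H n) ∧ H 0 = Real.cosh w ∧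
    2*w*H 1 = Real.sinh w ∧ ∀ n : ℕ, H n = (4*n+2) * H (n+1) + 4*w^2*H (n+2) := by
  refine ⟨fun n => ∑' j, hCoef n j * w^(2*j), ?_, ?_, ?_, ?_⟩
  · intro n
    refine (hCoef_summable w n).tsum_pos (fun j => ?_) 0 ?_
    · have := hCoef_pos n j
      have : 0 ≤ w^(2*j) := by rw [pow_mul]; positivity
      positivity
    · simpa using hCoef_pos n 0
  · rw [← (Real.hasSum_cosh w).tsum_eq]
    apply tsum_congr
    intro j
    unfold hCoef
    have := Nat.factorial_pos j
    simp only [Nat.zero_add, Nat.mul_zero]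
    field_simp
  · rw [← (Real.hasSum_sinh w).tsum_eq, ← tsum_mul_left]
    apply tsum_congr
    intro j
    unfold hCoef
    have := Nat.factorial_pos j
    have e2 : 2*1+2*j = (2*j+1)+1 := by ring
    rw [add_comm 1 j, e2, Nat.factorial_succ j, Nat.factorial_succ (2*j+1)]
    have := Nat.factorial_pos (2*j+1)
    push_cast
    field_simp
    ring
  · intro n
    have s1 := hCoef_summable w n
    have s2 := hCoef_summable w (n+1)
    have s3 := hCoef_summable w (n+2)
    show (∑' j, hCoef n j * w^(2*j)) = (4*n+2) * (∑' j, hCoef (n+1) j * w^(2*j)) + 4*w^2*(∑' j, hCoef (n+2) j * w^(2*j))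
    rw [s1.tsum_eq_zero_add, s2.tsum_eq_zero_add, mul_add, ← tsum_mul_left, ← tsum_mul_left, add_assoc,
      ← Summable.tsum_add]
    · congr 1
      · rw [hCoef_step n 0]; push_cast; ring
      · apply tsum_congr
        intro j
        rw [hCoef_step n (j+1), ← hCoef_shift n j]
        push_cast; ring
    · exact ((summable_nat_add_iff 1).2 s2).mul_left _
    · exact s3.mul_left _

/-- numerators of the convergents -/
def cf (s t : ℤ) : ℕ → ℤ
  | 0 => 1
  | 1 => 2*t+s
  | (n+2) => (4*n+6)*t*cf s t (n+1) + s^2*cf s t n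

lemma cf_two (s t : ℤ) (n : ℕ) : cf s t (n+2) = (4*n+6)*t*cf s t (n+1) + s^2*cf s t n := rfl

lemma cf_closed (s t : ℤ) (n : ℕ) : (cf s t n : ℚ) =
    ∑ p ∈ antidiagonal n, ((2*p.1+p.2).factorial : ℚ) / (p.1.factorial * p.2.factorial) * t^p.1 * s^p.2 := by
  induction n using Nat.twoStepInduction with
  | zero => simp [cf]
  | one => simp [cf, Finset.Nat.antidiagonal_succ]; ring
  | more n ih1 ih2 =>
    have key : ∀ p ∈ antidiagonal (n+2), ((2*p.1+p.2).factorial : ℚ) / (p.1.factorial * p.2.factorial) * t^p.1 * s^p.2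
       = (p.1:ℚ)*(4*n+6) * ((2*p.1+p.2-2).factorial : ℚ) / (p.1.factorial * p.2.factorial) * t^p.1 * s^p.2
        + (p.2:ℚ)*(p.2-1) * ((2*p.1+p.2-2).factorial : ℚ) / (p.1.factorial * p.2.factorial) * t^p.1 * s^p.2 := by
      rintro ⟨j,k⟩ hp
      rw [HasAntidiagonal.mem_antidiagonal] at hp
      simp only at hp ⊢
      obtain ⟨q, hq⟩ : ∃ q, 2*j+k = q+2 := ⟨2*j+k-2, by omega⟩
      rw [hq, Nat.factorial_succ, Nat.factorial_succ, Nat.add_sub_cancel]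
      have h1 : (q:ℚ) = 2*j+k-2 := by
        have : ((2*j+k:ℕ):ℚ) = ((q+2:ℕ):ℚ) := by rw [hq]
        push_cast at this; linarith
      have h2 : (n:ℚ) = j+k-2 := by
        have : ((j+k:ℕ):ℚ) = ((n+2:ℕ):ℚ) := by rw [hp]
        push_cast at this; linarith
      push_cast
      rw [h1, h2]
      ring
    rw [Finset.sum_congr rfl key, Finset.sum_add_distrib, cf_two]
    push_cast
    rw [ih1, ih2, Finset.mul_sum, Finset.mul_sum]
    congr 1
    · rw [Finset.Nat.sum_antidiagonal_succ (n := n+1)]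
      simp only [Nat.cast_zero, zero_mul, zero_div, zero_add]
      apply Finset.sum_congr rfl
      rintro ⟨j,k⟩ hp
      have : 2*(j+1)+k-2 = 2*j+k := by omega
      simp only [this, Nat.factorial_succ j]
      push_cast
      field_simp
      ring
    · rw [Finset.Nat.sum_antidiagonal_succ' (n := n+1), Finset.Nat.sum_antidiagonal_succ']
      simp only [Nat.cast_zero, zero_mul, zero_div, zero_add, Nat.cast_one, sub_self, mul_zero]
      apply Finset.sum_congr rfl
      rintro ⟨j,k⟩ hp
      have : 2*j+(k+1+1)-2 = 2*j+k := by omega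
      simp only [this, Nat.factorial_succ]
      push_cast
      field_simp
      try ring

lemma cf_closed_int (s t : ℤ) (n : ℕ) : cf s t n =
    ∑ p ∈ antidiagonal n, ((2*p.1+p.2).choose p.1 * n.descFactorial p.1 : ℕ) * t^p.1 * s^p.2 := by
  have h := cf_closed s t n
  have : (cf s t n : ℚ) = ((∑ p ∈ antidiagonal n, ((2*p.1+p.2).choose p.1 * n.descFactorial p.1 : ℕ) * t^p.1 * s^p.2 : ℤ) : ℚ) := by
    rw [h]
    push_cast
    apply Finset.sum_congr rfl
    rintro ⟨j,k⟩ hp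
    rw [HasAntidiagonal.mem_antidiagonal] at hp
    simp only at hp ⊢
    subst hp
    congr 2
    have h1 := Nat.choose_mul_factorial_mul_factorial (n := 2*j+k) (k := j) (by omega)
    have h2 := Nat.factorial_mul_descFactorial (n := j+k) (k := j) (by omega)
    rw [show 2*j+k-j = j+k by omega] at h1
    rw [show j+k-j = k by omega] at h2
    rw [← h1, ← h2]
    have := Nat.factorial_pos j
    have := Nat.factorial_pos k
    push_cast
    field_simp
  exact_mod_cast this

lemma dvd_cf_odd (s t : ℤ) (n p : ℕ) (hp : p.Prime) (hps : (p:ℤ) ∣ s) :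
    ((p ^ (padicValNat p n.factorial) : ℕ) : ℤ) ∣ cf s t n := by
  have := Fact.mk hp
  rw [cf_closed_int]
  apply Finset.dvd_sum
  rintro ⟨j,k⟩ hjk
  rw [HasAntidiagonal.mem_antidiagonal] at hjk
  simp only at hjk ⊢
  subst hjk
  have h2 := Nat.factorial_mul_descFactorial (n := j+k) (k := j) (by omega)
  rw [show j+k-j = k by omega] at h2
  have hd0 : (j+k).descFactorial j ≠ 0 := by
    intro h0; rw [h0] at h2; have := Nat.factorial_pos (j+k); omega
  rw [← h2, padicValNat.mul (Nat.factorial_ne_zero _) hd0, pow_add]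
  have hk : padicValNat p k.factorial ≤ k := by
    have h := sub_one_mul_padicValNat_factorial (p := p) k
    have : 1 ≤ p - 1 := by have := hp.two_le; omega
    nlinarith [Nat.sub_le k (p.digits k).sum]
  have a1 : ((p ^ padicValNat p k.factorial : ℕ):ℤ) ∣ s^k := by
    push_cast
    exact (pow_dvd_pow _ hk).trans (pow_dvd_pow_of_dvd hps k)
  have a2 : ((p ^ padicValNat p ((j+k).descFactorial j) : ℕ):ℤ) ∣ ((j+k).descFactorial j : ℤ) := by
    exact_mod_cast pow_padicValNat_dvd
  push_cast at a1 a2 ⊢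
  calc _ ∣ s^k * ((j+k).descFactorial j : ℤ) := mul_dvd_mul a1 a2
    _ ∣ _ := ⟨((2*j+k).choose j) * t^j, by ring⟩

lemma dvd_cf_two (s t : ℤ) (n : ℕ) (hs : (2:ℤ) ∣ s) : (2:ℤ)^n ∣ cf s t n := by
  induction n using Nat.twoStepInduction with
  | zero => simp
  | one => simp only [cf, pow_one]; exact dvd_add (dvd_mul_right _ _) hs
  | more n ih1 ih2 =>
    rw [cf_two]
    obtain ⟨a, ha⟩ := ih1
    obtain ⟨b, hb⟩ := ih2
    obtain ⟨c, hc⟩ := hs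
    rw [ha, hb, hc]
    exact ⟨(2*n+3)*t*b + c^2*a, by ring⟩

/-- exponent -/
def eExp (n p : ℕ) : ℕ := if p = 2 then n else padicValNat p n.factorial

/-- common divisor -/
def Dn (s : ℤ) (n : ℕ) : ℕ := ∏ p ∈ s.natAbs.primeFactors, p ^ eExp n p

lemma Dn_dvd (s s' t : ℤ) (h : s'.natAbs = s.natAbs) (n : ℕ) : (Dn s n : ℤ) ∣ cf s' t n := by
  unfold Dn
  push_cast
  apply Finset.prod_dvd_of_coprime
  · intro p hp q hq hpq
    have hp' := Nat.prime_of_mem_primeFactors hp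
    have hq' := Nat.prime_of_mem_primeFactors hq
    have := Nat.coprime_pow_primes (eExp n p) (eExp n q) hp' hq' hpq
    show IsCoprime _ _
    simpa using Nat.isCoprime_iff_coprime.2 this
  · intro p hp
    have hp' := Nat.prime_of_mem_primeFactors hp
    have hd : (p:ℤ) ∣ s' := by
      rw [Int.natCast_dvd, h]; exact Nat.dvd_of_mem_primeFactors hp
    unfold eExp
    split_ifs with h2
    · subst h2; exact dvd_cf_two s' t n hd
    · exact_mod_cast dvd_cf_odd s' t n p hp' hd

lemma Dn_pos (s : ℤ) (n : ℕ) : 0 < Dn s n := by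
  unfold Dn
  apply Finset.prod_pos
  intro p hp
  exact pow_pos (Nat.prime_of_mem_primeFactors hp).pos _

lemma Dn_mono (s : ℤ) (n : ℕ) : Dn s n ≤ Dn s (n+1) := by
  unfold Dn
  apply Finset.prod_le_prod' 
  intro p hp
  have hp' := Nat.prime_of_mem_primeFactors hp
  have := Fact.mk hp'
  apply Nat.pow_le_pow_right hp'.pos
  unfold eExp
  split_ifs
  · omega
  · rw [Nat.factorial_succ, padicValNat.mul (by omega) (Nat.factorial_ne_zero _)]
    omega

lemma Dn_one (s : ℤ) (hs : s ≠ 0) : Dn s 1 = Int.gcd 2 s := by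
  unfold Dn
  by_cases h : (2:ℤ) ∣ s
  · have h2 : 2 ∈ s.natAbs.primeFactors := by
      rw [Nat.mem_primeFactors]
      exact ⟨Nat.prime_two, by omega, by omega⟩
    rw [Finset.prod_eq_single_of_mem 2 h2]
    · rw [Int.gcd_eq_left_iff_dvd (by norm_num) |>.2 h |> fun e => (by exact_mod_cast e : Int.gcd 2 s = 2)]
      simp [eExp]
    · intro b _ hb
      simp [eExp, hb]
  · have : Int.gcd 2 s = 1 := by
      rw [← Int.isCoprime_iff_gcd_eq_one]
      exact (Int.prime_two.coprime_iff_not_dvd).2 h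
    rw [this]
    apply Finset.prod_eq_one
    intro p hp
    have : p ≠ 2 := by
      rintro rfl
      apply h
      have := Nat.dvd_of_mem_primeFactors hp
      omega
    simp [eExp, this]

lemma alpha_pos (s : ℤ) : 0 < alphaS s := by
  unfold alphaS
  apply Finset.prod_pos
  intro p hp
  have := (Nat.prime_of_mem_primeFactors hp).pos
  positivity

lemma alpha_le (s : ℤ) (hs : s ≠ 0) : alphaS s ≤ |(s:ℝ)| := by
  have h1 : alphaS s ≤ ∏ p ∈ s.natAbs.primeFactors, (p:ℝ) := by
    unfold alphaS
    apply Finset.prod_le_prod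
    · intro p hp; positivity
    · intro p hp
      have h2 : (2:ℝ) ≤ p := by exact_mod_cast (Nat.prime_of_mem_primeFactors hp).two_le
      conv_rhs => rw [← Real.rpow_one (p:ℝ)]
      apply Real.rpow_le_rpow_of_exponent_le (by linarith)
      rw [div_le_one (by linarith)]
      linarith
  have h2 : (∏ p ∈ s.natAbs.primeFactors, p) ≤ s.natAbs :=
    Nat.le_of_dvd (by omega) (Nat.prod_primeFactors_dvd _)
  have h3 : ((∏ p ∈ s.natAbs.primeFactors, p : ℕ):ℝ) ≤ (s.natAbs:ℝ) := by exact_mod_cast h2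
  have h4 : (s.natAbs:ℝ) = |(s:ℝ)| := by
    rw [Nat.cast_natAbs]; push_cast; rfl
  push_cast at h3
  linarith

lemma pow_val_ge (n p : ℕ) (hn : 1 ≤ n) (hp : p.Prime) :
    ((p : ℝ) ^ ((1 : ℝ) / ((p : ℝ) - 1)))^n ≤ (p:ℝ)^(padicValNat p n.factorial) * (p * n) := by
  have := Fact.mk hp
  have h2 : (2:ℝ) ≤ p := by exact_mod_cast hp.two_le
  have h := sub_one_mul_padicValNat_factorial (p := p) n
  have hle := Nat.digit_sum_le p n
  have hlen := Nat.base_pow_length_digits_le p n hp.one_lt (by omega)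
  have hsum : (p.digits n).sum ≤ (p-1) * (p.digits n).length := by
    have := List.sum_le_card_nsmul (p.digits n) (p-1) (fun d hd => by
      have := Nat.digits_lt_base hp.one_lt hd; omega)
    simpa [mul_comm] using this
  have hkey : n ≤ (p-1) * (padicValNat p n.factorial + (p.digits n).length) := by
    rw [mul_add, h]; omega
  have hkeyR : (n:ℝ) ≤ (p-1) * ((padicValNat p n.factorial:ℝ) + (p.digits n).length) := by
    have : ((p-1:ℕ):ℝ) = (p:ℝ)-1 := by
      rw [Nat.cast_sub hp.one_le]; simp
    rw [← this]; exact_mod_cast hkey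
  have hlenR : (p:ℝ)^((p.digits n).length) ≤ p * n := by exact_mod_cast hlen
  calc ((p : ℝ) ^ ((1 : ℝ) / ((p : ℝ) - 1)))^n = (p:ℝ)^((n:ℝ)/(p-1)) := by
        rw [← Real.rpow_natCast, ← Real.rpow_mul (by linarith)]
        congr 1; ring
    _ ≤ (p:ℝ)^(((padicValNat p n.factorial + (p.digits n).length : ℕ):ℝ)) := by
        apply Real.rpow_le_rpow_of_exponent_le (by linarith)
        rw [div_le_iff₀ (by linarith)]
        push_cast
        linarith
    _ = (p:ℝ)^(padicValNat p n.factorial) * (p:ℝ)^((p.digits n).length) := by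
        rw [Real.rpow_natCast, pow_add]
    _ ≤ _ := by gcongr

lemma Dn_ge (s : ℤ) (n : ℕ) (hn : 1 ≤ n) :
    (alphaS s)^n ≤ (Dn s n : ℝ) * ((gammaS s : ℝ) * (n:ℝ)^(betaS s)) := by
  have e : (gammaS s : ℝ) * (n:ℝ)^(betaS s) = ∏ p ∈ s.natAbs.primeFactors, (if p = 2 then (1:ℝ) else p * n) := by
    unfold gammaS betaS
    push_cast
    rw [← Finset.prod_const, ← Finset.prod_mul_distrib]
    have h1 : ∏ p ∈ s.natAbs.primeFactors.erase 2, ((p:ℝ) * n) =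
      ∏ p ∈ s.natAbs.primeFactors.erase 2, (if p = 2 then (1:ℝ) else p * n) := by
      apply Finset.prod_congr rfl
      intro p hp
      rw [if_neg (Finset.ne_of_mem_erase hp)]
    rw [h1]
    apply Finset.prod_erase
    simp
  rw [e]
  unfold alphaS Dn
  push_cast
  rw [← Finset.prod_pow, ← Finset.prod_mul_distrib]
  apply Finset.prod_le_prod
  · intro p hp; positivity
  · intro p hp
    have hp' := Nat.prime_of_mem_primeFactors hp
    unfold eExp
    split_ifs with h2
    · subst h2
      norm_num
    · exact pow_val_ge n p hn hp'

lemma gamma_pos (s : ℤ) : 0 < gammaS s := by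
  unfold gammaS
  apply Finset.prod_pos
  intro p hp
  exact (Nat.prime_of_mem_primeFactors (Finset.mem_of_mem_erase hp)).pos

lemma log_le_sqrt (x : ℝ) (hx : 1 ≤ x) : Real.log x ≤ √x - 1/√x := by
  have hs : 0 < √x := Real.sqrt_pos.2 (by linarith)
  have h0 : 0 ≤ Real.log (√x) := Real.log_nonneg (by rw [Real.one_le_sqrt]; exact hx)
  have h := Real.self_le_sinh_iff.2 h0
  rw [Real.sinh_log hs, Real.log_sqrt (by linarith)] at h
  rw [one_div]
  linarith

lemma log_step (n : ℝ) (hn : 1 ≤ n) :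
    (n+1) * Real.log (n+1) ≤ 1 + Real.log (n+1/2) + n * Real.log n := by
  have hp2 : √(2*n)^2 = 2*n := Real.sq_sqrt (by linarith)
  have hq2 : √(2*n+1)^2 = 2*n+1 := Real.sq_sqrt (by linarith)
  have hr2 : √(2*n+2)^2 = 2*n+2 := Real.sq_sqrt (by linarith)
  have hp : 0 < √(2*n) := Real.sqrt_pos.2 (by linarith)
  have hq : 0 < √(2*n+1) := Real.sqrt_pos.2 (by linarith)
  have hr : 0 < √(2*n+2) := Real.sqrt_pos.2 (by linarith)
  have ha := log_le_sqrt ((2*n+2)/(2*n+1)) (by rw [one_le_div (by linarith)]; linarith)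
  have hb := log_le_sqrt ((2*n+1)/(2*n)) (by rw [one_le_div (by linarith)]; linarith)
  rw [Real.sqrt_div (by linarith)] at ha hb
  have ea : Real.log ((2*n+2)/(2*n+1)) = Real.log (n+1) - Real.log (n+1/2) := by
    rw [← Real.log_div (by linarith) (by linarith)]
    congr 1; field_simp
  have eb : Real.log ((2*n+1)/(2*n)) = Real.log (n+1/2) - Real.log n := by
    rw [← Real.log_div (by linarith) (by linarith)]
    congr 1; field_simp
  rw [ea] at ha
  rw [eb] at hb
  set p := √(2*n)
  set q := √(2*n+1)
  set r := √(2*n+2)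
  have ha' : (n+1) * (r/q - 1/(r/q)) = r/(2*q) := by
    have : n + 1 = r^2/2 := by linarith
    rw [this]
    have : r^2 - q^2 = 1 := by linarith
    field_simp
    rw [this]
  have hb' : n * (q/p - 1/(q/p)) = p/(2*q) := by
    have : n = p^2/2 := by linarith
    rw [this]
    have : q^2 - p^2 = 1 := by linarith
    field_simp
    rw [this]
  have hsum : r/(2*q) + p/(2*q) ≤ 1 := by
    rw [← add_div, div_le_one (by linarith)]
    nlinarith [sq_nonneg (r-p)]
  have h1 := mul_le_mul_of_nonneg_left ha (show 0 ≤ n+1 by linarith)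
  have h2 := mul_le_mul_of_nonneg_left hb (show 0 ≤ n by linarith)
  linarith

/-- product of 4i+2 -/
def Pn : ℕ → ℝ
  | 0 => 1
  | (n+1) => (4*n+6) * Pn n

lemma Pn_pos (n : ℕ) : 0 < Pn n := by
  induction n with
  | zero => simp [Pn]
  | succ n ih => simp only [Pn]; positivity

lemma Pn_ge (n : ℕ) : (2*n+1) * (√2 / √(Real.exp 1)) * (4*n/Real.exp 1)^n ≤ Pn n := by
  have he := Real.exp_one_gt_d9
  have hc : √2 / √(Real.exp 1) ≤ 1 := by
    rw [div_le_one (Real.sqrt_pos.2 (Real.exp_pos 1))]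
    exact Real.sqrt_le_sqrt (by linarith)
  have hc0 : 0 ≤ √2 / √(Real.exp 1) := by positivity
  set c := √2 / √(Real.exp 1)
  induction n with
  | zero => simp [Pn]; exact hc
  | succ n ih =>
    simp only [Pn]
    rcases Nat.eq_zero_or_pos n with h0 | h0
    · subst h0
      simp [Pn]
      norm_num
      have h3 : 4 / Real.exp 1 ≤ 2 := by
        rw [div_le_iff₀ (Real.exp_pos 1)]; linarith
      have : 0 < 4 / Real.exp 1 := by positivity
      nlinarith
    · have hn : (1:ℝ) ≤ n := by exact_mod_cast h0
      have hl := log_step n hn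
      have key : ((n:ℝ)+1)^(n+1) ≤ Real.exp 1 * (n+1/2) * (n:ℝ)^n := by
        rw [← Real.log_le_log_iff (by positivity) (by positivity), Real.log_mul (by positivity) (by positivity),
          Real.log_mul (by positivity) (by positivity), Real.log_pow, Real.log_pow, Real.log_exp]
        push_cast
        linarith
      have key2 : (4*((n:ℝ)+1)/Real.exp 1)^(n+1) ≤ (4*n+2) * (4*n/Real.exp 1)^n := by
        rw [div_pow, div_pow, mul_pow, mul_pow, div_le_iff₀ (by positivity)]
        calc 4^(n+1) * ((n:ℝ)+1)^(n+1) ≤ 4^(n+1) * (Real.exp 1 * (n+1/2) * (n:ℝ)^n) := by gcongr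
          _ = _ := by field_simp; ring
      push_cast
      calc (2*((n:ℝ)+1)+1) * c * (4*((n:ℝ)+1)/Real.exp 1)^(n+1)
          ≤ (2*((n:ℝ)+1)+1) * c * ((4*n+2) * (4*n/Real.exp 1)^n) := by gcongr
        _ = (4*n+6) * ((2*n+1) * c * (4*n/Real.exp 1)^n) := by ring
        _ ≤ _ := by gcongr

lemma zFun_spec (y : ℝ) (hy : Real.exp 1 ≤ y) (y1 : ℝ) (hy1 : Real.exp 1 ≤ y1) (h : y1 * Real.log y1 ≤ y) :
    zFun y * Real.log (zFun y) = y ∧ y1 ≤ zFun y := by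
  have he : (1:ℝ) < Real.exp 1 := by have := Real.exp_one_gt_d9; linarith
  have hly : 1 ≤ Real.log y := by
    rw [Real.le_log_iff_exp_le (by linarith)]; exact hy
  have hex : ∃ a ∈ Set.Ici (Real.exp (-1)), (fun x : ℝ => x * Real.log x) a = y := by
    have hcont : ContinuousOn (fun x : ℝ => x * Real.log x) (Set.Icc 1 y) :=
      Real.continuous_mul_log.continuousOn
    have := intermediate_value_Icc (show (1:ℝ) ≤ y by linarith) hcont
    obtain ⟨a, ha, hay⟩ := this (show y ∈ Set.Icc _ _ by
      simp only [Set.mem_Icc, Real.log_one]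
      constructor
      · linarith
      · nlinarith)
    refine ⟨a, ?_, hay⟩
    have h1 : Real.exp (-1) ≤ 1 := Real.exp_le_one_iff.2 (by norm_num)
    exact le_trans h1 ha.1
  have h1 := Function.invFunOn_eq hex
  have h2 := Function.invFunOn_mem hex
  change zFun y * Real.log (zFun y) = y at h1
  change Real.exp (-1) ≤ zFun y at h2
  refine ⟨h1, ?_⟩
  by_contra hlt
  push Not at hlt
  have hz0 : 0 < zFun y := lt_of_lt_of_le (Real.exp_pos _) h2
  have hlog : Real.log (zFun y) < Real.log y1 := Real.log_lt_log hz0 hlt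
  have hl1 : 0 < Real.log y1 := Real.log_pos (by linarith)
  nlinarith


lemma r_formula (s t : ℤ) (hs : s ≠ 0) (ht : 0 < t) : ∃ (ε : ℝ) (ρ : ℕ → ℝ),
    (ε = 1 ∧ 0 < s ∨ ε = -1 ∧ s < 0) ∧ (∀ n, 0 < ρ n) ∧
    (∀ n : ℕ, (cf (-s) t n : ℝ) * Real.exp ((s:ℝ)/t) - cf s t n = (-1)^n * ε * ρ n) ∧
    (∀ n : ℕ, (s:ℝ)^2 * ρ n = (4*n+6) * t * ρ (n+1) + ρ (n+2)) := by
  obtain ⟨H, Hpos, H0, H1, Hrec⟩ := exists_H ((s:ℝ)/(2*t))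
  have htR : (0:ℝ) < t := by exact_mod_cast ht
  have hsR : (s:ℝ) ≠ 0 := by exact_mod_cast hs
  obtain ⟨ε, hε⟩ : ∃ ε : ℝ, (ε = 1 ∧ 0 < s ∨ ε = -1 ∧ s < 0) := by
    rcases lt_or_gt_of_ne hs with h | h
    · exact ⟨-1, Or.inr ⟨rfl, h⟩⟩
    · exact ⟨1, Or.inl ⟨rfl, h⟩⟩
  have hεs : 0 < ε * s := by
    rcases hε with ⟨h1, h2⟩ | ⟨h1, h2⟩
    · have : (0:ℝ) < s := by exact_mod_cast h2
      rw [h1]; linarith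
    · have : (s:ℝ) < 0 := by exact_mod_cast h2
      rw [h1]; linarith
  have hε2 : ε * ε = 1 := by
    rcases hε with ⟨h1, h2⟩ | ⟨h1, h2⟩ <;> rw [h1] <;> norm_num
  set w : ℝ := (s:ℝ)/(2*t) with hw
  have hrec' : ∀ n : ℕ, (t:ℝ)^2 * H (n+1) = (4*n+6) * t^2 * H (n+2) + s^2 * H (n+3) := by
    intro n
    rw [Hrec (n+1), hw]
    push_cast
    field_simp
    ring
  refine ⟨ε, fun n => 2 * Real.exp w * (ε * s) * (s^2)^n / t^(n+1) * H (n+1), hε, ?_, ?_, ?_⟩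
  · intro n
    have := Hpos (n+1)
    positivity
  · have hE : Real.exp ((s:ℝ)/t) = Real.exp w * Real.exp w := by
      rw [← Real.exp_add]; congr 1; rw [hw]; field_simp; ring
    have hE1 : Real.exp w * Real.exp (-w) = 1 := by rw [← Real.exp_add]; simp
    have hsinh : Real.exp w * (2 * Real.sinh w) = Real.exp ((s:ℝ)/t) - 1 := by
      rw [Real.sinh_eq, hE, ← hE1]; ring
    have hcosh : Real.exp w * (2 * Real.cosh w) = Real.exp ((s:ℝ)/t) + 1 := by
      rw [Real.cosh_eq, hE, ← hE1]; ring
    have h2w : 2 * w = s / t := by rw [hw]; field_simp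
    intro n
    induction n using Nat.twoStepInduction with
    | zero =>
      simp only [cf, pow_zero, Int.cast_one, one_mul]
      rw [← hsinh, ← H1, h2w]
      have e : ε * (2 * Real.exp w * (ε * s) * 1 / t^(0+1) * H (0+1)) = (ε*ε) * (2 * Real.exp w * s / t * H 1) := by
        simp only [zero_add, pow_one]; ring
      rw [e, hε2]
      ring
    | one =>
      simp only [cf]
      push_cast
      have h := Hrec 0
      rw [H0] at h
      have e1 : (s:ℝ)^2 / t^2 * H 2 = Real.cosh w - 2 * H 1 := by
        rw [h, hw]; push_cast; field_simp; ring
      have e2 : (s:ℝ)/t * H 1 = Real.sinh w := by rw [← H1, h2w]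
      have e3 : (-1:ℝ)^1 * ε * (2 * Real.exp w * (ε * s) * (s^2)^1 / t^(1+1) * H (1+1))
          = - (ε*ε) * s * (2 * Real.exp w) * ((s:ℝ)^2 / t^2 * H 2) := by ring
      rw [e3, e1, hε2]
      have e4 : (s:ℝ) * H 1 = t * Real.sinh w := by rw [← e2]; field_simp
      have e5 : -1 * (s:ℝ) * (2*Real.exp w) * (Real.cosh w - 2 * H 1)
        = - s * (Real.exp w * (2 * Real.cosh w)) + 2 * (2 * Real.exp w) * (s * H 1) := by ring
      rw [e5, e4, hcosh]
      linear_combination (-(2:ℝ)*t) * hsinh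
    | more n ih1 ih2 =>
      rw [cf_two, cf_two]
      push_cast
      have e : ((4 * (n:ℝ) + 6) * t * (cf (-s) t (n + 1)) + (-(s:ℝ)) ^ 2 * (cf (-s) t n)) * Real.exp ((s:ℝ) / t) -
          ((4 * n + 6) * t * (cf s t (n + 1)) + (s:ℝ) ^ 2 * (cf s t n))
        = (4*n+6)*t*((cf (-s) t (n+1) : ℝ) * Real.exp ((s:ℝ)/t) - cf s t (n+1))
          + (s:ℝ)^2 * ((cf (-s) t n : ℝ) * Real.exp ((s:ℝ)/t) - cf s t n) := by ring
      rw [e, ih1, ih2]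
      have := hrec' n
      have e2 : (s:ℝ)^2 * H (n+2+1) = t^2 * H (n+1) - (4*n+6)*t^2*H (n+2) := by
        rw [this]; ring
      have e3 : (2 * Real.exp w * (ε * s) * ((s:ℝ)^2)^(n+2) / t^(n+2+1) * H (n+2+1))
        = (2 * Real.exp w * (ε * s) * ((s:ℝ)^2)^(n+1) / t^(n+2+1) * ((s:ℝ)^2 * H (n+2+1))) := by ring
      rw [e3, e2]
      field_simp
      ring
  · intro n
    have := hrec' n
    have e3 : (2 * Real.exp w * (ε * s) * ((s:ℝ)^2)^(n+2) / t^(n+2+1) * H (n+2+1))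
        = (2 * Real.exp w * (ε * s) * ((s:ℝ)^2)^(n+1) / t^(n+2+1) * ((s:ℝ)^2 * H (n+3))) := by ring
    have e2 : (s:ℝ)^2 * H (n+3) = t^2 * H (n+1) - (4*n+6)*t^2*H (n+2) := by
      rw [this]; ring
    simp only
    rw [e3, e2]
    field_simp
    ring

lemma cf_pos (s t : ℤ) (hs : 0 < s) (ht : 0 < t) (n : ℕ) : 0 < cf s t n := by
  induction n using Nat.twoStepInduction with
  | zero => simp [cf]
  | one => simp only [cf]; positivity
  | more n ih1 ih2 => rw [cf_two]; positivity

lemma cf_det (s t : ℤ) (n : ℕ) :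
    cf s t (n+1) * cf (-s) t n - cf s t n * cf (-s) t (n+1) = (-1)^n * (2 * s * (s^2)^n) := by
  induction n with
  | zero => simp [cf]; ring
  | succ n ih =>
    rw [cf_two, cf_two]
    have : (-1:ℤ)^(n+1) * (2*s*(s^2)^(n+1)) = - s^2 * ((-1)^n * (2 * s * (s^2)^n)) := by ring
    rw [this, ← ih]; ring

/-- all the data needed for the main argument -/
lemma data (s t : ℤ) (hs : s ≠ 0) (ht : 0 < t) : ∃ (κ : ℝ) (C ρ : ℕ → ℝ), 0 ≤ κ ∧ κ ≤ 1 ∧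
    (∀ n, 0 < ρ n) ∧ (∀ n, 0 < C n) ∧
    (∀ n : ℕ, |(cf (-s) t n : ℝ) * Real.exp ((s:ℝ)/t) - cf s t n| = ρ n) ∧
    (∀ n : ℕ, (4*n+6) * t * ρ (n+1) ≤ (s:ℝ)^2 * ρ n) ∧
    (∀ n : ℕ, C (n+2) = (4*n+6) * t * C (n+1) + (s:ℝ)^2 * C n) ∧
    (∀ n : ℕ, C (n+1) * ρ n ≤ 2 * |(s:ℝ)| * ((s:ℝ)^2)^n) ∧
    (∀ n : ℕ, |(cf (-s) t n : ℝ)| ≤ C n + κ * ρ n) ∧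
    (∀ n : ℕ, κ * Dn s n ≤ C n) := by
  obtain ⟨ε, ρ, hε, hρ, hr, hrec⟩ := r_formula s t hs ht
  have htR : (0:ℝ) < t := by exact_mod_cast ht
  have hε2 : |ε| = 1 := by
    rcases hε with ⟨h1, h2⟩ | ⟨h1, h2⟩ <;> rw [h1] <;> norm_num
  have habs : ∀ n : ℕ, |(cf (-s) t n : ℝ) * Real.exp ((s:ℝ)/t) - cf s t n| = ρ n := by
    intro n
    rw [hr, abs_mul, abs_mul, abs_pow, abs_neg, abs_one, one_pow, hε2, abs_of_pos (hρ n)]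
    ring
  have hle : ∀ n : ℕ, (4*n+6) * t * ρ (n+1) ≤ (s:ℝ)^2 * ρ n := by
    intro n; rw [hrec]; have := hρ (n+2); linarith
  have hW : ∀ C : ℕ → ℝ, (∀ n, 0 < C n) → (∀ n : ℕ, C (n+2) = (4*n+6) * t * C (n+1) + (s:ℝ)^2 * C n) →
      C 1 * ρ 0 + C 0 * ρ 1 = 2 * |(s:ℝ)| → (∀ n : ℕ, C (n+1) * ρ n ≤ 2 * |(s:ℝ)| * ((s:ℝ)^2)^n) := by
    intro C hC hCrec h0 n
    have : C (n+1) * ρ n + C n * ρ (n+1) = 2 * |(s:ℝ)| * ((s:ℝ)^2)^n := by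
      induction n with
      | zero => simpa using h0
      | succ n ih =>
        rw [pow_succ, ← mul_assoc, ← ih, hCrec]
        linear_combination (-(C (n+1))) * hrec n
    have := mul_pos (hC n) (hρ (n+1))
    linarith
  have r0 := hr 0
  have r1 := hr 1
  simp only [cf] at r0 r1
  push_cast at r0 r1
  rcases hε with ⟨h1, h2⟩ | ⟨h1, h2⟩
  · have hsR : (0:ℝ) < s := by exact_mod_cast h2
    set E := Real.exp ((s:ℝ)/t) with hE
    have hE0 : 0 < E := Real.exp_pos _
    have hE1 : 1 < E := by
      rw [hE]; exact Real.one_lt_exp_iff.2 (by positivity)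
    refine ⟨1/E, fun n => cf s t n / E, ρ, by positivity, ?_, hρ, ?_, habs, hle, ?_, ?_, ?_, ?_⟩
    · rw [div_le_one hE0]; exact hE1.le
    · intro n
      have : (0:ℝ) < cf s t n := by exact_mod_cast cf_pos s t h2 ht n
      positivity
    · intro n; simp only [cf_two]; push_cast; field_simp
    · apply hW (fun n => cf s t n / E)
      · intro n
        have : (0:ℝ) < cf s t n := by exact_mod_cast cf_pos s t h2 ht n
        positivity
      · intro n; simp only [cf_two]; push_cast; field_simp
      · rw [abs_of_pos hsR]
        rw [h1] at r0 r1
        simp only [cf]; push_cast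
        have a0 : ρ 0 = E - 1 := by linarith
        have a1 : ρ 1 = (2*t+s) - (2*t-s)*E := by linarith
        rw [a0, a1]
        field_simp
        ring
    · intro n
      have hA : (0:ℝ) < cf s t n := by exact_mod_cast cf_pos s t h2 ht n
      have e : (cf (-s) t n : ℝ) = (cf s t n : ℝ) / E + 1/E * ((cf (-s) t n : ℝ) * E - cf s t n) := by
        field_simp; ring
      calc |(cf (-s) t n : ℝ)| = |(cf s t n : ℝ) / E + 1/E * ((cf (-s) t n : ℝ) * E - cf s t n)| := by rw [← e]
        _ ≤ |(cf s t n : ℝ) / E| + |1/E * ((cf (-s) t n : ℝ) * E - cf s t n)| := abs_add_le _ _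
        _ = _ := by
          rw [abs_mul, habs, abs_of_pos (by positivity), abs_of_pos (by positivity)]
    · intro n
      have hd := Int.le_of_dvd (cf_pos s t h2 ht n) (Dn_dvd s s t rfl n)
      have hdR : (Dn s n : ℝ) ≤ cf s t n := by exact_mod_cast hd
      rw [one_div, inv_mul_eq_div]
      exact div_le_div_of_nonneg_right hdR hE0.le
  · have hsR : (s:ℝ) < 0 := by exact_mod_cast h2
    have hBp : ∀ n, (0:ℝ) < cf (-s) t n := by
      intro n; exact_mod_cast cf_pos (-s) t (by omega) ht n
    have hBrec : ∀ n : ℕ, (cf (-s) t (n+2) : ℝ) = (4*n+6) * t * cf (-s) t (n+1) + (s:ℝ)^2 * cf (-s) t n := by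
      intro n; rw [cf_two]; push_cast; ring
    refine ⟨0, fun n => cf (-s) t n, ρ, le_refl _, zero_le_one, hρ, hBp, habs, hle, hBrec, ?_, ?_, ?_⟩
    · apply hW _ hBp hBrec
      rw [abs_of_neg hsR]
      rw [h1] at r0 r1
      simp only [cf]; push_cast
      have a0 : ρ 0 = 1 - Real.exp ((s:ℝ)/t) := by linarith
      have a1 : ρ 1 = (2*t-s)*Real.exp ((s:ℝ)/t) - (2*t+s) := by linarith
      rw [a0, a1]
      ring
    · intro n; rw [abs_of_pos (hBp n)]; simp
    · intro n; have := hBp n; rw [zero_mul]; exact this.le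

/-- the core inequality -/
lemma core (s t : ℤ) (hs : s ≠ 0) (ht : 0 < t) (M N : ℤ) (hN : 1 ≤ N) (ν : ℕ) (hν : 1 ≤ ν)
    (h1 : (Dn s ν : ℝ) / 2 ≤ N * |(cf (-s) t ν : ℝ) * Real.exp ((s:ℝ)/t) - cf s t ν|)
    (h2 : N * |(cf (-s) t (ν+1) : ℝ) * Real.exp ((s:ℝ)/t) - cf s t (ν+1)| < (Dn s (ν+1) : ℝ) / 2)
    (h3 : N * |(cf (-s) t (ν+2) : ℝ) * Real.exp ((s:ℝ)/t) - cf s t (ν+2)| < (Dn s (ν+2) : ℝ) / 2) :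
    1 < |Real.exp ((s:ℝ)/t) - M/N| * (8 * N^2 * ((4*ν+6)*t + s^2) * |(s:ℝ)| * ((s:ℝ)^2)^ν / (Dn s ν * Dn s (ν+1))) := by
  obtain ⟨κ, C, ρ, hκ0, hκ1, hρ, hC, habs, hle, hCrec, hCρ, hB, hκD⟩ := data s t hs ht
  rw [habs] at h1 h2 h3
  have htR : (1:ℝ) ≤ t := by exact_mod_cast ht
  have hNR : (1:ℝ) ≤ N := by exact_mod_cast hN
  have hs2 : (1:ℝ) ≤ (s:ℝ)^2 := by
    have : 1 ≤ s^2 := by have := sq_pos_of_ne_zero hs; omega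
    exact_mod_cast this
  have hν0 : (0:ℝ) ≤ ν := by positivity
  have hD : ∀ n, (0:ℝ) < Dn s n := fun n => by exact_mod_cast Dn_pos s n
  have hDm : (Dn s (ν+1):ℝ) ≤ Dn s (ν+2) := by exact_mod_cast Dn_mono s (ν+1)
  set δ := |Real.exp ((s:ℝ)/t) - M/N| with hδ
  have hδ0 : 0 ≤ δ := abs_nonneg _
  -- single-index estimate
  have single : ∀ n, N * ρ n < (Dn s n : ℝ)/2 → (N * cf s t n - M * cf (-s) t n ≠ 0) →
      1 < δ * (2 * N * C n / Dn s n + κ) := by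
    intro n hn hne
    obtain ⟨a, ha⟩ := Dn_dvd s s t rfl n
    obtain ⟨b, hb⟩ := Dn_dvd s (-s) t (by simp) n
    have hdv : (Dn s n : ℤ) ∣ N * cf s t n - M * cf (-s) t n := by
      rw [ha, hb]; exact ⟨N*a - M*b, by ring⟩
    have hge : (Dn s n : ℤ) ≤ |N * cf s t n - M * cf (-s) t n| :=
      Int.le_of_dvd (abs_pos.2 hne) ((dvd_abs _ _).2 hdv)
    have hgeR : (Dn s n : ℝ) ≤ |(N:ℝ) * cf s t n - M * cf (-s) t n| := by exact_mod_cast hge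
    have e : (N:ℝ) * cf s t n - M * cf (-s) t n = N * (cf (-s) t n * (Real.exp ((s:ℝ)/t) - M/N))
        - N * (cf (-s) t n * Real.exp ((s:ℝ)/t) - cf s t n) := by
      field_simp; ring
    have hle2 : |(N:ℝ) * cf s t n - M * cf (-s) t n| ≤ N * (|(cf (-s) t n:ℝ)| * δ) + N * ρ n := by
      rw [e]
      refine (abs_sub _ _).trans ?_
      rw [abs_mul, abs_mul, abs_mul, habs, abs_of_pos (show (0:ℝ) < N by linarith)]
    have hBn := hB n
    have h5 : |(cf (-s) t n:ℝ)| * δ ≤ (C n + κ * ρ n) * δ := by gcongr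
    have h6 : (Dn s n:ℝ)/2 < N * ((C n + κ * ρ n) * δ) := by nlinarith
    have h7 : N * ((C n + κ * ρ n) * δ) ≤ (N * C n + κ * (Dn s n/2)) * δ := by
      have : κ * (N * ρ n) ≤ κ * (Dn s n/2) := by gcongr
      nlinarith
    have h8 : (Dn s n:ℝ)/2 < (N * C n + κ * (Dn s n/2)) * δ := lt_of_lt_of_le h6 h7
    have hDn := hD n
    have e9 : δ * (2 * N * C n / Dn s n + κ) = ((N * C n + κ * (Dn s n/2)) * δ) / (Dn s n/2) := by
      field_simp
    rw [e9, one_lt_div (by linarith)]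
    exact h8
  have hC1 := hC (ν+1)
  have hC0 := hC ν
  have hCmono : 6 * C ν ≤ C (ν+1) := by
    obtain ⟨k, rfl⟩ : ∃ k, ν = k+1 := ⟨ν-1, by omega⟩
    rw [hCrec k]
    have hCk := hC k
    have : (6:ℝ) * C (k+1) ≤ (4*k+6)*t*C (k+1) := by
      have : (6:ℝ) ≤ (4*k+6)*t := by
        have : (0:ℝ) ≤ k := by positivity
        nlinarith
      gcongr
    nlinarith
  have hD1 := hD (ν+1)
  have hD0 := hD ν
  have hκ' : κ ≤ C (ν+1) / Dn s (ν+1) := by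
    rw [le_div_iff₀ hD1]; exact hκD (ν+1)
  have hfac : (6:ℝ) ≤ (4*ν+6)*t := by nlinarith
  have hX : 1 < δ * (2 * N * ((4*ν+6)*t + s^2) * C (ν+1) / Dn s (ν+1)) := by
    by_cases hz : N * cf s t (ν+1) - M * cf (-s) t (ν+1) = 0
    · have hz2 : N * cf s t (ν+2) - M * cf (-s) t (ν+2) ≠ 0 := by
        intro hz2
        have hdet := cf_det s t (ν+1)
        have e : N * ((-1)^(ν+1) * (2 * s * (s^2)^(ν+1))) = 0 := by
          rw [← hdet]
          linear_combination (cf (-s) t (ν+1)) * hz2 - cf (-s) t (ν+2) * hz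
        have hN0 : N ≠ 0 := by omega
        have : N * ((-1)^(ν+1) * (2 * s * (s^2)^(ν+1))) ≠ 0 := by positivity
        exact this e
      refine lt_of_lt_of_le (single (ν+2) h3 hz2) (mul_le_mul_of_nonneg_left ?_ hδ0)
      have hC2 := hC (ν+2)
      calc 2 * N * C (ν+2) / Dn s (ν+2) + κ ≤ 2 * N * C (ν+2) / Dn s (ν+1) + C (ν+1) / Dn s (ν+1) := by
            gcongr
        _ = (2 * N * ((4*ν+6)*t*C (ν+1) + s^2 * C ν) + C (ν+1)) / Dn s (ν+1) := by
            rw [hCrec ν]; ring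
        _ ≤ _ := by
            apply div_le_div_of_nonneg_right _ hD1.le
            have hNs : 1 ≤ (N:ℝ) * s^2 := by nlinarith
            have : (N:ℝ) * s^2 * (6 * C ν) ≤ N * s^2 * C (ν+1) := by gcongr
            nlinarith
    · refine lt_of_lt_of_le (single (ν+1) h2 hz) (mul_le_mul_of_nonneg_left ?_ hδ0)
      calc 2 * N * C (ν+1) / Dn s (ν+1) + κ ≤ 2 * N * C (ν+1) / Dn s (ν+1) + C (ν+1) / Dn s (ν+1) := by
            gcongr
        _ = (2 * N + 1) * C (ν+1) / Dn s (ν+1) := by ring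
        _ ≤ _ := by
            apply div_le_div_of_nonneg_right _ hD1.le
            apply mul_le_mul_of_nonneg_right _ hC1.le
            nlinarith
  refine lt_of_lt_of_le hX (mul_le_mul_of_nonneg_left ?_ hδ0)
  have hkey : C (ν+1) * Dn s ν ≤ 4 * N * (|(s:ℝ)| * ((s:ℝ)^2)^ν) := by
    calc C (ν+1) * Dn s ν ≤ C (ν+1) * (2 * (N * ρ ν)) := by
          apply mul_le_mul_of_nonneg_left _ hC1.le
          linarith
      _ = 2 * N * (C (ν+1) * ρ ν) := by ring
      _ ≤ 2 * N * (2 * |(s:ℝ)| * ((s:ℝ)^2)^ν) := by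
          apply mul_le_mul_of_nonneg_left (hCρ ν); linarith
      _ = _ := by ring
  have e1 : 2 * N * ((4*ν+6)*t + (s:ℝ)^2) * C (ν+1) / Dn s (ν+1)
     = 2 * N * ((4*ν+6)*t + (s:ℝ)^2) * (C (ν+1) * Dn s ν) / (Dn s ν * Dn s (ν+1)) := by
    field_simp
  have e2 : 8 * (N:ℝ)^2 * ((4*ν+6)*t + s^2) * |(s:ℝ)| * ((s:ℝ)^2)^ν / (Dn s ν * Dn s (ν+1))
     = 2 * N * ((4*ν+6)*t + (s:ℝ)^2) * (4 * N * (|(s:ℝ)| * ((s:ℝ)^2)^ν)) / (Dn s ν * Dn s (ν+1)) := by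
    ring
  rw [e1, e2]
  apply div_le_div_of_nonneg_right _ (by positivity)
  apply mul_le_mul_of_nonneg_left hkey
  have : (0:ℝ) ≤ N := by linarith
  positivity

lemma rho_le (s t : ℤ) (hs : s ≠ 0) (ht : 0 < t) (n : ℕ) :
    |(cf (-s) t n : ℝ) * Real.exp ((s:ℝ)/t) - cf s t n| * ((t:ℝ)^n * Pn n)
      ≤ |Real.exp ((s:ℝ)/t) - 1| * ((s:ℝ)^2)^n := by
  obtain ⟨κ, C, ρ, hκ0, hκ1, hρ, hC, habs, hle, hCrec, hCρ, hB, hκD⟩ := data s t hs ht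
  rw [habs]
  have htR : (0:ℝ) < t := by exact_mod_cast ht
  induction n with
  | zero =>
    have := habs 0
    simp only [cf] at this
    push_cast at this
    rw [one_mul] at this
    rw [this]; simp [Pn]
  | succ n ih =>
    simp only [Pn]
    have hP := Pn_pos n
    calc ρ (n+1) * ((t:ℝ)^(n+1) * ((4*n+6) * Pn n)) = ((4*n+6) * t * ρ (n+1)) * (t^n * Pn n) := by ring
      _ ≤ ((s:ℝ)^2 * ρ n) * (t^n * Pn n) := by
          apply mul_le_mul_of_nonneg_right (hle n); positivity
      _ = (s:ℝ)^2 * (ρ n * (t^n * Pn n)) := by ring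
      _ ≤ (s:ℝ)^2 * (|Real.exp ((s:ℝ)/t) - 1| * ((s:ℝ)^2)^n) := by
          apply mul_le_mul_of_nonneg_left ih; positivity
      _ = _ := by ring


lemma small_of_large (s t : ℤ) (hs : s ≠ 0) (ht : 0 < t) (N m : ℝ) (hN : 1 < N)
    (hm : Real.exp 1 ≤ sigmaS s t * m) (hmN : m * Real.log (sigmaS s t * m) = Real.log N)
    (hmη : etaS s t ≤ m + betaS s) (n : ℕ) (hn : m + betaS s < n) :
    N * |(cf (-s) t n : ℝ) * Real.exp ((s:ℝ)/t) - cf s t n| < (Dn s n : ℝ) / 2 := by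
  have htR : (0:ℝ) < t := by exact_mod_cast ht
  have hsR : (s:ℝ) ≠ 0 := by exact_mod_cast hs
  have hα := alpha_pos s
  have hγ : (0:ℝ) < gammaS s := by exact_mod_cast gamma_pos s
  have hσ : 0 < sigmaS s t := by unfold sigmaS; positivity
  have he1 : 1 < Real.exp 1 := by have := Real.exp_one_gt_d9; linarith
  have hm0 : 0 < m := by
    by_contra h
    push Not at h
    have := mul_nonneg_of_nonpos_of_nonpos h (neg_nonpos.2 hσ.le)
    nlinarith
  have hE : 0 < |Real.exp ((s:ℝ)/t) - 1| := by
    rw [abs_pos, sub_ne_zero]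
    intro h
    rw [Real.exp_eq_one_iff, div_eq_zero_iff] at h
    rcases h with h | h
    · exact hsR h
    · linarith
  have hβ0 : (0:ℝ) ≤ betaS s := by positivity
  have hn0 : (0:ℝ) < n := by linarith
  have hn1 : 1 ≤ n := by exact_mod_cast (Nat.cast_pos.1 hn0)
  set σ := sigmaS s t with hσd
  set F := |Real.exp ((s:ℝ)/t) - 1| with hF
  -- step 1
  have hη1 : √(Real.exp 1) * F * (gammaS s : ℝ) / (√2 * σ ^ (betaS s)) - 1/2 < n := by
    have : √(Real.exp 1) * F * (gammaS s : ℝ) / (√2 * σ ^ (betaS s)) - 1/2 ≤ etaS s t := le_max_left _ _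
    linarith
  have hq : 2 * F * gammaS s < (2*n+1) * (√2 / √(Real.exp 1)) * σ^(betaS s) := by
    have h2 : √(Real.exp 1) * F * (gammaS s : ℝ) / (√2 * σ ^ (betaS s)) < n + 1/2 := by linarith
    rw [div_lt_iff₀ (by positivity)] at h2
    have hs2 : √2 * √2 = 2 := Real.mul_self_sqrt (by norm_num)
    have hse : 0 < √(Real.exp 1) := by positivity
    have e : (2*n+1) * (√2 / √(Real.exp 1)) * σ^(betaS s) = ((2*n+1) * √2 * σ^(betaS s)) / √(Real.exp 1) := by ring
    rw [e, lt_div_iff₀ hse]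
    nlinarith
  -- step 2
  have hpow : N * (σ*n)^(betaS s) ≤ (σ*n)^n := by
    have hσn : σ * m < σ * n := by
      apply mul_lt_mul_of_pos_left _ hσ; linarith
    have hlog1 : 0 < Real.log (σ*m) := Real.log_pos (by linarith)
    have hlog : Real.log (σ*m) < Real.log (σ*n) := Real.log_lt_log (by linarith) hσn
    have hσn0 : 0 < σ * n := by positivity
    rw [← Real.log_le_log_iff (by positivity) (by positivity), Real.log_mul (by positivity) (by positivity),
      Real.log_pow, Real.log_pow, ← hmN]
    have h1 : m * Real.log (σ*m) ≤ (n - betaS s) * Real.log (σ*n) := by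
      apply mul_le_mul <;> linarith
    nlinarith
  have hρ := rho_le s t hs ht n
  have hP := Pn_ge n
  have hD := Dn_ge s n hn1
  have hPpos := Pn_pos n
  set ρ := |(cf (-s) t n : ℝ) * Real.exp ((s:ℝ)/t) - cf s t n|
  have hσeq : (σ*n)^n * ((s:ℝ)^2)^n = (t:ℝ)^n * (alphaS s)^n * (4*n/Real.exp 1)^n := by
    rw [← mul_pow, ← mul_pow, ← mul_pow]
    congr 1
    rw [hσd]; unfold sigmaS
    field_simp
  -- combine
  have hDpos : (0:ℝ) < Dn s n := by exact_mod_cast Dn_pos s n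
  set D := (Dn s n : ℝ)
  set β := betaS s
  set γ := (gammaS s : ℝ)
  set c := √2 / √(Real.exp 1)
  set S := ((s:ℝ)^2)^n with hS
  have hSpos : 0 < S := by positivity
  set Q := (4*n/Real.exp 1)^n
  -- N * F * S * 2 < D * t^n * P
  have hgoal : 2 * N * (F * S) < D * ((t:ℝ)^n * Pn n) := by
    have hx : 2 * N * (F * S) * (γ * (n:ℝ)^β * σ^β) < D * ((t:ℝ)^n * Pn n) * (γ * (n:ℝ)^β * σ^β) := by
      calc 2 * N * (F * S) * (γ * (n:ℝ)^β * σ^β) = (2 * F * γ) * (N * (σ*n)^β * S) := by rw [mul_pow]; ring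
        _ < ((2*n+1) * c * σ^β) * (N * (σ*n)^β * S) := by
            apply mul_lt_mul_of_pos_right hq; positivity
        _ ≤ ((2*n+1) * c * σ^β) * ((σ*n)^n * S) := by
            gcongr
        _ = ((2*n+1) * c * Q) * (t^n * (alphaS s)^n) * σ^β := by rw [hσeq]; ring
        _ ≤ Pn n * (t^n * (alphaS s)^n) * σ^β := by gcongr
        _ ≤ Pn n * (t^n * (D * (γ * (n:ℝ)^β))) * σ^β := by gcongr
        _ = _ := by ring
    exact lt_of_mul_lt_mul_right hx (by positivity)
  have htp : 0 < (t:ℝ)^n * Pn n := by positivity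
  have : 2 * N * (ρ * ((t:ℝ)^n * Pn n)) < D * ((t:ℝ)^n * Pn n) := by
    refine lt_of_le_of_lt ?_ hgoal
    gcongr
  have h3 : 2 * N * ρ * ((t:ℝ)^n * Pn n) < D * ((t:ℝ)^n * Pn n) := by linarith
  have := lt_of_mul_lt_mul_right h3 htp.le
  linarith

set_option maxHeartbeats 1000000 in
theorem rational_approx_exp_general (s t : ℤ) (hs : s ≠ 0) (ht : 0 < t)
    (hst : Int.gcd s t = 1) (M N : ℤ) (hM : M ≠ 0)
    (hN : (N : ℝ) ≥ Real.exp (logN1 s t)) :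
    1 < |Real.exp ((s : ℝ) / (t : ℝ)) - (M : ℝ) / (N : ℝ)| * ZS s t (N : ℝ) *
      (N : ℝ) ^ (2 + 2 * Real.log (|(s : ℝ)| / alphaS s)
        * zFun (sigmaS s t * Real.log (N : ℝ)) / (sigmaS s t * Real.log (N : ℝ))) := by
  have htR : (0:ℝ) < t := by exact_mod_cast ht
  have hsR : (s:ℝ) ≠ 0 := by exact_mod_cast hs
  have hα := alpha_pos s
  have hαs := alpha_le s hs
  have hγ : (0:ℝ) < gammaS s := by exact_mod_cast gamma_pos s
  have hσ : 0 < sigmaS s t := by unfold sigmaS; positivity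
  have he1 : 1 < Real.exp 1 := by have := Real.exp_one_gt_d9; linarith
  have hN0 : (0:ℝ) < N := lt_of_lt_of_le (Real.exp_pos _) hN
  have hlogN : logN1 s t ≤ Real.log N := (Real.le_log_iff_exp_le hN0).2 hN
  have hη2 : Real.exp 1 / sigmaS s t + betaS s ≤ etaS s t := le_max_right _ _
  have hy1 : Real.exp 1 ≤ sigmaS s t * (etaS s t - betaS s) := by
    rw [← div_le_iff₀' hσ]; linarith
  have hl1 : (etaS s t - (betaS s : ℝ)) * Real.log (sigmaS s t * (etaS s t - (betaS s : ℝ))) ≤ Real.log N :=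
    (le_max_left _ _).trans hlogN
  have hl2 : Real.log ((Int.gcd 2 s : ℝ)
        / |4 * (s : ℝ) + 2 * ((s : ℝ) - 2 * (t : ℝ)) * (Real.exp ((s : ℝ) / (t : ℝ)) - 1)|) ≤ Real.log N :=
    (le_max_right _ _).trans hlogN
  set σ := sigmaS s t with hσd
  set y1 := σ * (etaS s t - betaS s) with hy1d
  have hy1N : y1 * Real.log y1 ≤ σ * Real.log N := by
    rw [hy1d, mul_assoc]; exact mul_le_mul_of_nonneg_left hl1 hσ.le
  have hlogy1 : 1 ≤ Real.log y1 := by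
    rw [Real.le_log_iff_exp_le (by linarith)]; exact hy1
  have hyN : Real.exp 1 ≤ σ * Real.log N := by nlinarith
  have hlogpos : 0 < Real.log N := by
    by_contra h
    push Not at h
    nlinarith
  have hN1 : (1:ℝ) < N := (Real.log_pos_iff hN0.le).1 hlogpos
  have hN1' : 1 ≤ N := by
    have : (1:ℤ) < N := by exact_mod_cast hN1
    omega
  obtain ⟨hz1, hz2⟩ := zFun_spec (σ * Real.log N) hyN y1 hy1 hy1N
  set z := zFun (σ * Real.log N) with hzd
  set m := z / σ with hmd
  have hσm : σ * m = z := by rw [hmd]; field_simp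
  have hm0 : 0 < m := by
    have : 0 < z := by linarith
    positivity
  have hmN : m * Real.log (σ * m) = Real.log N := by
    rw [hσm]
    have : σ * (m * Real.log z) = σ * Real.log N := by rw [← mul_assoc, hσm, hz1]
    exact mul_left_cancel₀ hσ.ne' this
  have hmη : etaS s t ≤ m + betaS s := by
    have : σ * (etaS s t - betaS s) ≤ σ * m := by rw [hσm]; exact hz2
    have := le_of_mul_le_mul_left this hσ
    linarith
  have hsmall := small_of_large s t hs ht N m hN1 (by rw [← hσd, hσm]; linarith) hmN hmη
  -- index 1 is large
  obtain ⟨κ, C, ρ, hκ0, hκ1, hρ, hC, habs, hle, hCrec, hCρ, hB, hκD⟩ := data s t hs ht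
  have hone : (Dn s 1 : ℝ) / 2 ≤ N * |(cf (-s) t 1 : ℝ) * Real.exp ((s:ℝ)/t) - cf s t 1| := by
    rw [Dn_one s hs]
    have e : |4 * (s : ℝ) + 2 * ((s : ℝ) - 2 * (t : ℝ)) * (Real.exp ((s : ℝ) / (t : ℝ)) - 1)|
        = 2 * |(cf (-s) t 1 : ℝ) * Real.exp ((s:ℝ)/t) - cf s t 1| := by
      have : 4 * (s : ℝ) + 2 * ((s : ℝ) - 2 * (t : ℝ)) * (Real.exp ((s : ℝ) / (t : ℝ)) - 1)
        = (-2) * ((cf (-s) t 1 : ℝ) * Real.exp ((s:ℝ)/t) - cf s t 1) := by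
        simp only [cf]; push_cast; ring
      rw [this, abs_mul]; norm_num
    rw [e] at hl2
    have hp : 0 < |(cf (-s) t 1 : ℝ) * Real.exp ((s:ℝ)/t) - cf s t 1| := by rw [habs]; exact hρ 1
    have hg : (0:ℝ) < Int.gcd 2 s := by
      have : 0 < Int.gcd 2 s := Int.gcd_pos_of_ne_zero_left _ (by norm_num)
      exact_mod_cast this
    have := (Real.log_le_log_iff (by positivity) hN0).1 hl2
    rw [div_le_iff₀ (by positivity)] at this
    linarith
  -- choice of ν
  classical
  let P : ℕ → Prop := fun n => (Dn s n : ℝ) / 2 ≤ N * |(cf (-s) t n : ℝ) * Real.exp ((s:ℝ)/t) - cf s t n|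
  have hPb : ∀ n, P n → (n:ℝ) ≤ m + betaS s := by
    intro n hPn
    by_contra h
    push Not at h
    have := hsmall n h
    have h' : (Dn s n : ℝ) / 2 ≤ N * |(cf (-s) t n : ℝ) * Real.exp ((s:ℝ)/t) - cf s t n| := hPn
    linarith
  set K := ⌊m + betaS s⌋₊ with hK
  have hPK : ∀ n, P n → n ≤ K := fun n h => Nat.le_floor (hPb n h)
  set ν := Nat.findGreatest P K with hνd
  have hPν : P ν := Nat.findGreatest_spec (hPK 1 hone) hone
  have hν1 : 1 ≤ ν := Nat.le_findGreatest (hPK 1 hone) hone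
  have hnot : ∀ n, ν < n → ¬ P n := fun n hn hPn =>
    absurd (Nat.le_findGreatest (hPK n hPn) hPn) (by omega)
  have hcore := core s t hs ht M N hN1' ν hν1 hPν (not_le.1 (hnot (ν+1) (by omega))) (not_le.1 (hnot (ν+2) (by omega)))
  refine lt_of_lt_of_le hcore ?_
  rw [mul_assoc |Real.exp ((s : ℝ) / (t : ℝ)) - (M : ℝ) / (N : ℝ)| (ZS s t (N : ℝ))]
  apply mul_le_mul_of_nonneg_left _ (abs_nonneg _)
  have hνm : (ν:ℝ) ≤ m + betaS s := hPb ν hPν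
  -- the exponent
  set a := |(s:ℝ)| / alphaS s with ha
  have hs_abs : 0 < |(s:ℝ)| := abs_pos.2 hsR
  have ha0 : 0 < a := by positivity
  have ha1 : 1 ≤ a := by rw [ha, one_le_div hα]; exact hαs
  have ha2 : a^2 = (s:ℝ)^2 / (alphaS s)^2 := by rw [ha, div_pow, sq_abs]
  have hexp : (N:ℝ) ^ (2 + 2 * Real.log a * z / (σ * Real.log N)) = (N:ℝ)^2 * (a^2)^m := by
    rw [Real.rpow_add hN0]
    congr 1
    · norm_cast
    · rw [Real.rpow_def_of_pos hN0, Real.rpow_def_of_pos (by positivity), Real.log_pow]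
      congr 1
      rw [hmd]; push_cast; field_simp
  rw [hexp]
  have hζ : zetaS s t N = m + betaS s := rfl
  unfold ZS
  rw [hζ, ← ha2]
  set ζ := m + (betaS s : ℝ) with hζd
  set β := betaS s
  set γ := (gammaS s : ℝ)
  have hζ0 : 0 < ζ := by positivity
  have hE : 0 ≤ |Real.exp ((s:ℝ)/t) - 1| := abs_nonneg _
  have hD : ∀ n, (0:ℝ) < Dn s n := fun n => by exact_mod_cast Dn_pos s n
  have hD0 := Dn_ge s ν hν1
  have hD1 := Dn_ge s (ν+1) (by omega)
  have hν0 : (1:ℝ) ≤ ν := by exact_mod_cast hν1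
  have b0 : 1 / (Dn s ν : ℝ) ≤ γ * (ν:ℝ)^β / (alphaS s)^ν := by
    rw [div_le_div_iff₀ (hD ν) (by positivity)]; linarith
  have b1 : 1 / (Dn s (ν+1) : ℝ) ≤ γ * ((ν:ℝ)+1)^β / (alphaS s)^(ν+1) := by
    push_cast at hD1
    rw [div_le_div_iff₀ (hD _) (by positivity)]; linarith
  have hpw : (a^2)^ν ≤ (a^2)^β * (a^2)^m := by
    have : (a^2)^β * (a^2)^m = (a^2)^((m + (β:ℝ))) := by
      rw [add_comm, Real.rpow_add (by positivity), Real.rpow_natCast]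
    rw [this, ← Real.rpow_natCast]
    apply Real.rpow_le_rpow_of_exponent_le _ hνm
    exact one_le_pow₀ ha1
  calc 8 * (N:ℝ)^2 * ((4*ν+6)*t + s^2) * |(s:ℝ)| * ((s:ℝ)^2)^ν / (Dn s ν * Dn s (ν+1))
      = 8 * (N:ℝ)^2 * ((4*ν+6)*t + s^2) * |(s:ℝ)| * ((s:ℝ)^2)^ν * ((1 / (Dn s ν : ℝ)) * (1 / Dn s (ν+1))) := by
        field_simp
    _ ≤ 8 * (N:ℝ)^2 * ((4*ν+6)*t + s^2) * |(s:ℝ)| * ((s:ℝ)^2)^ν *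
        ((γ * (ν:ℝ)^β / (alphaS s)^ν) * (γ * ((ν:ℝ)+1)^β / (alphaS s)^(ν+1))) := by
        have := hD (ν+1)
        gcongr
    _ = 8 * γ^2 * |(s:ℝ)| * (4*t*ν+6*t + s^2) * (ν:ℝ)^β / alphaS s * ((ν:ℝ)+1)^β * (N:ℝ)^2 * (a^2)^ν := by
        rw [ha2, div_pow]
        field_simp
        try ring
    _ ≤ 8 * γ^2 * |(s:ℝ)| * (4*t*ζ+6*t + s^2) * ζ^β / alphaS s * (ζ+1)^β * (N:ℝ)^2 * ((a^2)^β * (a^2)^m) := by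
        gcongr
    _ = (a^2 * (ζ+1))^β * (8 * γ^2 * |(s:ℝ)| * (4*t*ζ+6*t + s^2) * ζ^β / alphaS s) * ((N:ℝ)^2 * (a^2)^m) := by
        rw [mul_pow]; ring
    _ ≤ _ := by
        have : 0 ≤ (Int.gcd 2 s : ℝ) * (alphaS s) ^ 2 * γ
          / ((N:ℝ) ^ 2 * (s : ℝ) ^ 2 * |Real.exp ((s : ℝ) / (t : ℝ)) - 1|) := by positivity
        gcongr
        linarith
end

section
/- For all nonzero integers M and all integers N with log N ≥ 983, one has 1 < |e³ − M/N| · 1561 · N^{2 + log 3 ·(1 + 4·ε(N))/log log N} · (log N / log log N)³. -/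
open Real

/-- `ε(N) = log log log N / log log N`. -/
noncomputable def epsN (N : ℝ) : ℝ :=
  Real.log (Real.log (Real.log N)) / Real.log (Real.log N)

/-- Pade sums for `exp`. -/
def padeS (n : ℕ) (a : ℤ) : ℤ :=
  ∑ k ∈ Finset.range (n + 1), a ^ k * (((2 * n - k).choose n * (n.factorial / k.factorial) : ℕ) : ℤ)

/-- the common power of three. -/
def padeD (n : ℕ) : ℕ := 3 ^ padicValNat 3 n.factorial

open Polynomial in
lemma eval_sumIDeriv_aux (n : ℕ) (f : ℝ[X]) (r : ℝ) (a : ℤ) (hf : f.natDegree ≤ 2 * n)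
    (h : taylor r f = X ^ n * (X + C (a : ℝ)) ^ n) :
    (sumIDeriv f).eval r = n.factorial * (padeS n a : ℝ) := by
  have hd : ∀ j, (derivative^[j] f).eval r = j.factorial * (taylor r f).coeff j := by
    intro j
    rw [taylor_coeff, ← factorial_smul_hasseDeriv]
    simp
  rw [sumIDeriv_apply_of_le hf, eval_finsetSum]
  simp_rw [hd, h]
  have e : 2 * n + 1 = n + (n + 1) := by ring
  rw [e, Finset.sum_range_add]
  have z : ∑ x ∈ Finset.range n, (x.factorial : ℝ) * (X ^ n * (X + C (a : ℝ)) ^ n).coeff x = 0 := by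
    apply Finset.sum_eq_zero
    intro x hx
    rw [coeff_X_pow_mul', if_neg (by simpa using hx), mul_zero]
  rw [z, zero_add, padeS, ← Finset.sum_range_reflect]
  simp only [Int.cast_sum, Int.cast_mul, Int.cast_pow, Int.cast_natCast, Nat.cast_mul]
  rw [Finset.mul_sum]
  apply Finset.sum_congr rfl
  intro k hk
  have hk' : k ≤ n := by simpa [Nat.lt_succ_iff] using hk
  obtain ⟨i, rfl⟩ := Nat.exists_eq_add_of_le hk'
  have h1 : k + i - k = i := by omega
  rw [Nat.add_sub_cancel, h1, coeff_X_pow_mul', if_pos (by omega), Nat.add_sub_cancel_left, coeff_X_add_C_pow]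
  have h2 : 2 * (k + i) - k = (k + i) + i := by omega
  rw [h2, Nat.add_sub_cancel]
  have h3 : ((k + i + i).choose (k + i) : ℝ) * (k+i).factorial * i.factorial = (k + i + i).factorial := by
    have := Nat.add_choose_mul_factorial_mul_factorial (k+i) i
    rw [← Nat.choose_symm_add] at this
    exact_mod_cast this
  have h4 : ((k + i).choose i : ℝ) * k.factorial * i.factorial = (k + i).factorial := by
    have := Nat.add_choose_mul_factorial_mul_factorial k i
    exact_mod_cast this
  rw [Nat.cast_div (Nat.factorial_dvd_factorial (by omega)) (by positivity)]
  rw [← h3, ← h4]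
  field_simp

open Polynomial in
lemma pade_identity (n : ℕ) : exp 3 * (padeS n (-3) : ℝ) - padeS n 3 =
    exp 3 / n.factorial * ∫ x in (0:ℝ)..3, exp (-x) * (x * (x - 3)) ^ n := by
  set f : ℝ[X] := X ^ n * (X - C 3) ^ n with hf
  have hdeg : f.natDegree ≤ 2 * n := by
    rw [hf]; compute_degree!
    omega
  have h0 := eval_sumIDeriv_aux n f 0 (-3) hdeg (by simp [hf, sub_eq_add_neg])
  have h3 := eval_sumIDeriv_aux n f 3 3 hdeg (by simp [hf, taylor_mul, taylor_pow]; ring)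
  have hI : ∫ x in (0:ℝ)..3, exp (-x) * (x * (x - 3)) ^ n =
      (-(exp (-3) * (sumIDeriv f).eval 3)) - (-(exp (-0) * (sumIDeriv f).eval 0)) := by
    apply intervalIntegral.integral_eq_sub_of_hasDerivAt (f := fun x => -(exp (-x) * (sumIDeriv f).eval x))
    · intro x _
      have h₁ := (hasDerivAt_id' x).fun_neg.exp
      have h₂ := (sumIDeriv f).hasDerivAt x
      convert! (h₁.mul h₂).fun_neg using 1
      nth_rw 1 [sumIDeriv_eq_self_add f]
      simp only [eval_add, hf, eval_mul, eval_pow, eval_X, eval_sub, eval_C, mul_pow]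
      ring
    · apply Continuous.intervalIntegrable
      fun_prop
  rw [hI, h0, h3, exp_neg]
  have := exp_pos 3
  simp
  field_simp
  ring

lemma pade_abs (n : ℕ) : |exp 3 * (padeS n (-3) : ℝ) - padeS n 3| ≤
    3 * exp 3 * (9 / 4) ^ n / n.factorial := by
  rw [pade_identity, abs_mul, abs_of_pos (by positivity)]
  have : |∫ x in (0:ℝ)..3, exp (-x) * (x * (x - 3)) ^ n| ≤ (9/4)^n * |3 - 0| := by
    rw [← Real.norm_eq_abs]
    apply intervalIntegral.norm_integral_le_of_norm_le_const
    intro x hx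
    rw [Set.uIoc_of_le (by norm_num)] at hx
    rw [norm_mul, norm_pow, Real.norm_of_nonneg (exp_pos _).le]
    have h1 : exp (-x) ≤ 1 := by rw [exp_le_one_iff]; linarith [hx.1]
    have h2 : ‖x * (x - 3)‖ ≤ 9 / 4 := by
      rw [Real.norm_eq_abs, abs_le]; constructor
      · nlinarith [sq_nonneg (x - 3/2)]
      · nlinarith [hx.1, hx.2]
    calc rexp (-x) * ‖x * (x - 3)‖ ^ n ≤ 1 * (9/4)^n := by gcongr
      _ = _ := one_mul _
  calc _ ≤ exp 3 / n.factorial * ((9/4)^n * |3 - 0|) := by gcongr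
    _ = _ := by norm_num; ring

lemma pade_sign (n : ℕ) : 0 < (-1) ^ n * (exp 3 * (padeS n (-3) : ℝ) - padeS n 3) := by
  rw [pade_identity]
  have h : (-1) ^ n * (∫ x in (0:ℝ)..3, exp (-x) * (x * (x - 3)) ^ n) =
      ∫ x in (0:ℝ)..3, exp (-x) * (x * (3 - x)) ^ n := by
    rw [← intervalIntegral.integral_const_mul]
    congr 1; ext x
    have : (x * (3 - x)) = (-1) * (x * (x - 3)) := by ring
    rw [this, mul_pow (-1 : ℝ)]; ring
  have h2 : 0 < ∫ x in (0:ℝ)..3, exp (-x) * (x * (3 - x)) ^ n := by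
    apply intervalIntegral.intervalIntegral_pos_of_pos_on
    · apply Continuous.intervalIntegrable
      fun_prop
    · intro x hx
      have : 0 < x * (3 - x) := mul_pos hx.1 (by linarith [hx.2])
      positivity
    · norm_num
  rw [mul_left_comm, h]
  positivity

lemma padeD_pos (n : ℕ) : 0 < padeD n := by unfold padeD; positivity

lemma padeD_dvd_term (n k : ℕ) (hk : k ≤ n) :
    padeD n ∣ 3 ^ k * ((2 * n - k).choose n * (n.factorial / k.factorial)) := by
  have h := Nat.div_mul_cancel (Nat.factorial_dvd_factorial hk)
  set t := n.factorial / k.factorial with ht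
  have ht0 : t ≠ 0 := by
    rintro h0
    rw [h0, zero_mul] at h
    exact (Nat.factorial_ne_zero n) h.symm
  have hv : padicValNat 3 k.factorial ≤ k := by
    have := sub_one_mul_padicValNat_factorial (p := 3) k
    omega
  unfold padeD
  rw [← h, padicValNat.mul ht0 (Nat.factorial_ne_zero k), pow_add]
  have h1 : 3 ^ padicValNat 3 t ∣ t := pow_padicValNat_dvd
  have h2 : 3 ^ padicValNat 3 k.factorial ∣ 3 ^ k := pow_dvd_pow 3 hv
  have := mul_dvd_mul h1 h2
  refine this.trans ⟨(2 * n - k).choose n, by ring⟩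

lemma padeD_dvd_pos (n : ℕ) : (padeD n : ℤ) ∣ padeS n 3 := by
  unfold padeS
  apply Finset.dvd_sum
  intro k hk
  exact_mod_cast padeD_dvd_term n k (by simpa [Nat.lt_succ_iff] using hk)

lemma padeD_dvd_neg (n : ℕ) : (padeD n : ℤ) ∣ padeS n (-3) := by
  unfold padeS
  apply Finset.dvd_sum
  intro k hk
  have h : (padeD n : ℤ) ∣ 3 ^ k * (((2 * n - k).choose n * (n.factorial / k.factorial) : ℕ) : ℤ) := by
    exact_mod_cast padeD_dvd_term n k (by simpa [Nat.lt_succ_iff] using hk)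
  rw [neg_pow, mul_assoc]
  exact h.mul_left _

lemma padeS_pos (n : ℕ) : 0 < padeS n 3 := by
  unfold padeS
  apply Finset.sum_pos
  · intro k hk
    have hk : k ≤ n := by simpa [Nat.lt_succ_iff] using hk
    have h1 : 0 < (2 * n - k).choose n := Nat.choose_pos (by omega)
    have h2 : 0 < n.factorial / k.factorial :=
      Nat.div_pos (Nat.factorial_le hk) (Nat.factorial_pos k)
    positivity
  · simp

lemma padeS_abs (n : ℕ) : |(padeS n (-3) : ℝ)| ≤ exp 3 * 4 ^ n * n.factorial := by
  unfold padeS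
  simp only [Int.cast_sum, Int.cast_mul, Int.cast_pow, Int.cast_natCast, Nat.cast_mul, Int.cast_neg, Int.cast_ofNat]
  refine (Finset.abs_sum_le_sum_abs _ _).trans ?_
  have h := Real.sum_le_exp_of_nonneg (x := 3) (by norm_num) (n + 1)
  calc _ ≤ ∑ k ∈ Finset.range (n + 1), (3 ^ k / k.factorial : ℝ) * (4 ^ n * n.factorial) := by
        apply Finset.sum_le_sum
        intro k hk
        have hk : k ≤ n := by simpa [Nat.lt_succ_iff] using hk
        rw [abs_mul, abs_pow, abs_neg, abs_of_pos (by norm_num : (0:ℝ) < 3), abs_of_nonneg (by positivity)]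
        rw [Nat.cast_div (Nat.factorial_dvd_factorial (by omega)) (by positivity)]
        have h1 : ((2 * n - k).choose n : ℝ) ≤ 4 ^ n := by
          have h2 : (2 * n - k).choose n ≤ 4 ^ n := by
            calc _ ≤ 2 ^ (2 * n - k) := Nat.choose_le_two_pow _ _
              _ ≤ 2 ^ (2 * n) := Nat.pow_le_pow_right (by norm_num) (by omega)
              _ = 4 ^ n := by rw [pow_mul]; norm_num
          exact_mod_cast h2
        calc _ ≤ (3:ℝ) ^ k * (4 ^ n * (n.factorial / k.factorial)) := by gcongr
          _ = _ := by ring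
    _ = (∑ k ∈ Finset.range (n + 1), (3 ^ k / k.factorial : ℝ)) * (4 ^ n * n.factorial) := by
        rw [Finset.sum_mul]
    _ ≤ exp 3 * (4 ^ n * n.factorial) := by gcongr
    _ = _ := by ring

lemma padeD_lower (n : ℕ) : (3:ℝ) ^ n ≤ (padeD n : ℝ) ^ 2 * (9 * (n + 1) ^ 2) := by
  have h := sub_one_mul_padicValNat_factorial (p := 3) n
  have hs : (Nat.digits 3 n).sum ≤ 2 * (Nat.digits 3 n).length := by
    rw [mul_comm]
    have := List.sum_le_card_nsmul (Nat.digits 3 n) 2 (fun x hx => by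
      have := Nat.digits_lt_base (b := 3) (by norm_num) hx
      omega)
    simpa using this
  have hl : 3 ^ (Nat.digits 3 n).length ≤ 3 * (n + 1) := by
    by_cases hn : n = 0
    · simp [hn]
    · exact (Nat.base_pow_length_digits_le 3 n (by norm_num) hn).trans (by omega)
  have : 3 ^ n ≤ (padeD n) ^ 2 * (9 * (n + 1) ^ 2) := by
    unfold padeD
    calc 3 ^ n ≤ 3 ^ (padicValNat 3 n.factorial * 2 + (Nat.digits 3 n).length * 2) :=
          Nat.pow_le_pow_right (by norm_num) (by omega)
      _ = (3 ^ padicValNat 3 n.factorial) ^ 2 * (3 ^ (Nat.digits 3 n).length) ^ 2 := by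
          rw [pow_add, pow_mul, pow_mul]
      _ ≤ (3 ^ padicValNat 3 n.factorial) ^ 2 * (3 * (n + 1)) ^ 2 := by gcongr
      _ = _ := by ring
  exact_mod_cast this

lemma padeD_mono {m n : ℕ} (h : m ≤ n) : padeD m ≤ padeD n := by
  unfold padeD
  apply Nat.pow_le_pow_right (by norm_num)
  exact (padicValNat_dvd_iff_le (Nat.factorial_ne_zero n)).1
    (pow_padicValNat_dvd.trans (Nat.factorial_dvd_factorial h))

/-- Upper bound for the reduced linear form. -/
noncomputable def padeR (n : ℕ) : ℝ := 3 * exp 3 * (9 / 4) ^ n / (n.factorial * padeD n)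

/-- Upper bound for the reduced denominator. -/
noncomputable def padeP (n : ℕ) : ℝ := exp 3 * 4 ^ n * n.factorial / padeD n

lemma padeR_pos (n : ℕ) : 0 < padeR n := by
  have := padeD_pos n
  unfold padeR; positivity

lemma padeR_succ (n : ℕ) (hn : 2 ≤ n) : padeR (n + 1) ≤ padeR n := by
  have h1 := padeD_pos n
  have h2 : (padeD n : ℝ) ≤ padeD (n + 1) := by exact_mod_cast padeD_mono (Nat.le_succ n)
  unfold padeR
  rw [Nat.factorial_succ]
  have hn' : (2:ℝ) ≤ n := by exact_mod_cast hn
  have h3 : (padeD n : ℝ) * n.factorial * (9/4) ≤ padeD (n + 1) * n.factorial * (n + 1) := by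
    gcongr
    linarith
  have h4 : (0:ℝ) < padeD (n+1) := by exact_mod_cast padeD_pos (n+1)
  push_cast
  rw [div_le_div_iff₀ (by positivity) (by positivity), pow_succ]
  have h5 : (0:ℝ) ≤ 3 * exp 3 * (9/4)^n := by positivity
  nlinarith [mul_le_mul_of_nonneg_left h3 h5]

lemma core_dichotomy (M N : ℤ) (hN : 0 < N) (m : ℕ) (h : 2 * N * padeR m ≤ 1) :
    1 ≤ 2 * padeP m * N * |exp 3 - (M : ℝ) / N| ∨ 0 < (-1) ^ m * (exp 3 - (M : ℝ) / N) := by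
  obtain ⟨p, hp⟩ := padeD_dvd_neg m
  obtain ⟨q, hq⟩ := padeD_dvd_pos m
  have hd : (0:ℝ) < padeD m := by exact_mod_cast padeD_pos m
  have hdz : (0:ℤ) < padeD m := by exact_mod_cast padeD_pos m
  have hNr : (1:ℝ) ≤ N := by exact_mod_cast hN
  have hpr : (padeS m (-3) : ℝ) = padeD m * p := by rw [hp]; push_cast; ring
  have hqr : (padeS m 3 : ℝ) = padeD m * q := by rw [hq]; push_cast; ring
  have hS := pade_sign m
  have hA := pade_abs m
  have hP := padeS_abs m
  rw [hpr, hqr] at hS hA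
  rw [hpr] at hP
  have e1 : exp 3 * (padeD m * p) - padeD m * q = padeD m * (exp 3 * p - q) := by ring
  rw [e1] at hS hA
  have hA' : |exp 3 * p - q| ≤ padeR m := by
    rw [abs_mul, abs_of_pos hd] at hA
    unfold padeR
    rw [← div_div, le_div_iff₀ hd]
    linarith
  have hP' : |(p:ℝ)| ≤ padeP m := by
    rw [abs_mul, abs_of_pos hd] at hP
    unfold padeP
    rw [le_div_iff₀ hd]
    linarith
  have hS' : 0 < (-1) ^ m * (exp 3 * p - q) := by
    rw [mul_left_comm] at hS
    exact pos_of_mul_pos_right hS hd.le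
  have hR : padeR m ≤ 1 / 2 := by nlinarith [padeR_pos m]
  have hq1 : (1:ℝ) ≤ q := by
    have : 0 < q := by
      have := padeS_pos m
      rw [hq] at this
      exact pos_of_mul_pos_right this hdz.le
    exact_mod_cast this
  have hp0 : (0:ℝ) < p := by
    have := (abs_le.1 hA').1
    have h3 : 0 < exp 3 * p := by linarith
    exact pos_of_mul_pos_right h3 (exp_pos 3).le
  have hN0 : (0:ℝ) < N := by linarith
  by_cases hz : p * M - q * N = 0
  · right
    have hz' : (p:ℝ) * M = q * N := by
      have : p * M = q * N := by linarith
      exact_mod_cast this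
    have e2 : exp 3 - (M:ℝ) / N = (exp 3 * p - q) / p := by
      field_simp
      linarith
    rw [e2, ← mul_div_assoc]
    positivity
  · left
    have h1 : (1:ℝ) ≤ |(p:ℝ) * M - q * N| := by
      have := Int.one_le_abs hz
      exact_mod_cast this
    have e3 : (p:ℝ) * M - q * N = N * (exp 3 * p - q) - p * N * (exp 3 - (M : ℝ) / N) := by
      field_simp
      ring
    rw [e3] at h1
    have h2 := abs_sub (N * (exp 3 * p - q)) (p * N * (exp 3 - (M : ℝ) / N))
    rw [abs_mul, abs_mul, abs_mul, abs_of_pos hN0] at h2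
    have h3 : (N:ℝ) * |exp 3 * p - q| ≤ N * padeR m := by gcongr
    have h4 : |(p:ℝ)| * N * |exp 3 - (M:ℝ)/N| ≤ padeP m * N * |exp 3 - (M:ℝ)/N| := by gcongr
    nlinarith

lemma core_bound (M N : ℤ) (hN : 0 < N) (n : ℕ) (hn : 2 ≤ n) (h : 2 * N * padeR n ≤ 1) :
    ∃ m, (m = n ∨ m = n + 1) ∧ 1 ≤ 2 * padeP m * N * |exp 3 - (M : ℝ) / N| := by
  have hN0 : (0:ℝ) < N := by exact_mod_cast hN
  have h' : 2 * N * padeR (n + 1) ≤ 1 := by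
    refine le_trans ?_ h
    have := padeR_succ n hn
    gcongr
  rcases core_dichotomy M N hN n h with h1 | h1
  · exact ⟨n, Or.inl rfl, h1⟩
  rcases core_dichotomy M N hN (n + 1) h' with h2 | h2
  · exact ⟨n + 1, Or.inr rfl, h2⟩
  exfalso
  rw [pow_succ] at h2
  linarith

lemma exp_three_lt : exp 3 < 20.1 := by
  have h : exp 3 = exp 1 ^ 3 := by rw [← exp_nat_mul]; norm_num
  rw [h]
  have := exp_one_lt_d9
  calc exp 1 ^ 3 < 2.7182818286 ^ 3 := by gcongr
    _ < 20.1 := by norm_num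

lemma prod_bound (k m : ℕ) (hm : m = k + 1 ∨ m = k + 2) :
    2 * padeP m * (2 * padeR k) ≤ 700000 * 3 ^ k * ((k:ℝ) + 2) ^ 4 := by
  have hk := padeD_lower k
  have hdk : (0:ℝ) < padeD k := by exact_mod_cast padeD_pos k
  have hdm : (padeD k : ℝ) ≤ padeD m := by exact_mod_cast padeD_mono (by omega)
  have h1 : padeP m ≤ exp 3 * (16 * 4 ^ k) * ((k + 2) ^ 2 * k.factorial) / padeD k := by
    unfold padeP
    have hf : (m.factorial : ℝ) ≤ (k + 2) ^ 2 * k.factorial := by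
      have hkp : (0:ℝ) < k.factorial := by positivity
      have hk0 : (0:ℝ) ≤ k := by positivity
      rcases hm with rfl | rfl
      · rw [Nat.factorial_succ]; push_cast
        gcongr
        nlinarith
      · rw [Nat.factorial_succ, Nat.factorial_succ]; push_cast
        rw [← mul_assoc]
        gcongr
        nlinarith
    have h4 : (4:ℝ) ^ m ≤ 16 * 4 ^ k := by
      have : (4:ℝ) ^ m ≤ 4 ^ (k + 2) := pow_le_pow_right₀ (by norm_num) (by omega)
      rw [pow_add] at this; linarith
    gcongr
  have hR := padeR_pos k
  calc 2 * padeP m * (2 * padeR k)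
      ≤ 2 * (exp 3 * (16 * 4 ^ k) * ((k + 2) ^ 2 * k.factorial) / padeD k) * (2 * padeR k) := by
        gcongr
    _ = 192 * exp 3 ^ 2 * (k + 2) ^ 2 * (4 ^ k * (9 / 4) ^ k) / padeD k ^ 2 := by
        unfold padeR
        field_simp
        ring
    _ = 192 * exp 3 ^ 2 * (k + 2) ^ 2 * (3 ^ k * 3 ^ k) / padeD k ^ 2 := by
        rw [← mul_pow, ← mul_pow]; norm_num
    _ ≤ 192 * exp 3 ^ 2 * (k + 2) ^ 2 * (3 ^ k * (padeD k ^ 2 * (9 * (k + 1) ^ 2))) / padeD k ^ 2 := by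
        gcongr
    _ = 1728 * exp 3 ^ 2 * 3 ^ k * ((k + 2) ^ 2 * (k + 1) ^ 2) := by
        field_simp
        ring
    _ ≤ 1728 * 20.1 ^ 2 * 3 ^ k * ((k + 2) ^ 2 * (k + 2) ^ 2) := by
        have := exp_three_lt
        gcongr; linarith
    _ ≤ _ := by
        have : (0:ℝ) ≤ 3 ^ k * ((k:ℝ) + 2) ^ 4 := by positivity
        nlinarith

/-- Numerical facts on `x = log N`, `L = log x`, `l = log L`. -/
lemma num_facts (x : ℝ) (hx : 983 ≤ x) :
    6.88 ≤ log x ∧ 1.9 ≤ log (log x) ∧ log (log x) ≤ 0.2817 * log x := by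
  have h2 := log_two_gt_d9
  have h2' := log_two_lt_d9
  have hL : 6.88 ≤ log x := by
    have h1 : log (983:ℝ) ≤ log x := log_le_log (by norm_num) hx
    have h3 : log (983:ℝ) = 10 * log 2 + log (983 / 1024) := by
      rw [log_div (by norm_num) (by norm_num)]
      have : (1024:ℝ) = 2 ^ 10 := by norm_num
      rw [this, log_pow]; push_cast; ring
    have h4 := one_sub_inv_le_log_of_pos (x := 983 / 1024) (by norm_num)
    norm_num at h4 h2 ⊢
    linarith
  have h8 : ∀ t : ℝ, 0 < t → log t = 3 * log 2 + log (t / 8) := by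
    intro t ht
    rw [log_div ht.ne' (by norm_num)]
    have : (8:ℝ) = 2 ^ 3 := by norm_num
    rw [this, log_pow]; push_cast; ring
  refine ⟨hL, ?_, ?_⟩
  · have h1 : log (6.88:ℝ) ≤ log (log x) := log_le_log (by norm_num) hL
    have h4 := one_sub_inv_le_log_of_pos (x := 6.88 / 8) (by norm_num)
    have := h8 6.88 (by norm_num)
    norm_num at h1 h4 h2 this ⊢
    linarith
  · have h7 := h8 7 (by norm_num)
    have h5 := log_le_sub_one_of_pos (x := 7 / 8) (by norm_num)
    have h6 := log_le_sub_one_of_pos (x := log x / 7) (by linarith)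
    rw [log_div (by linarith) (by norm_num)] at h6
    norm_num at h5 h2' hL ⊢
    linarith

lemma y_facts (x L l y : ℝ) (hL : L = log x) (hl : l = log L) (hy : y = x / L)
    (hx : 983 ≤ x) : 0 < y ∧ log y = L - l ∧ 128 ≤ y ∧ y * L = x := by
  obtain ⟨h1, h2, h3⟩ := num_facts x hx
  rw [← hL] at h1 h2 h3
  rw [← hl] at h2 h3
  have hL0 : 0 < L := by linarith
  have hy0 : 0 < y := by rw [hy]; positivity
  have hlog : log y = L - l := by
    rw [hy, log_div (by linarith) hL0.ne', ← hL, ← hl]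
  refine ⟨hy0, hlog, ?_, by rw [hy]; field_simp⟩
  rw [← log_le_log_iff (by norm_num) hy0, hlog]
  have : (128:ℝ) = 2 ^ 7 := by norm_num
  rw [this, log_pow]
  have := log_two_lt_d9
  norm_num at *
  linarith

lemma padeR_small (x L l y w : ℝ) (hL : L = log x) (hl : l = log L) (hy : y = x / L)
    (hw : w = l / L) (hx : 983 ≤ x) (m : ℕ) (hm : y * (1 + 3 * w) ≤ m) (hm2 : m ≤ 2 * y) :
    2 * exp x * padeR m ≤ 1 := by
  obtain ⟨h1, h2, h3⟩ := num_facts x hx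
  rw [← hL] at h1 h2 h3
  rw [← hl] at h2 h3
  obtain ⟨hy0, hlogy, hy128, hyL⟩ := y_facts x L l y hL hl hy hx
  have hL0 : 0 < L := by linarith
  have hw0 : 0 < w := by rw [hw]; exact div_pos (by linarith) hL0
  have hw1 : w ≤ 0.2817 := by rw [hw, div_le_iff₀ hL0]; exact h3
  have hwL : w * L = l := by rw [hw]; field_simp
  set c : ℝ := 1 + 3 / 2 * log 3 - 2 * log 2 with hc
  have hc1 : c ≤ 1.27 := by
    have := log_two_gt_d9
    have := log_three_lt_d9
    norm_num at *
    linarith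
  have hz0 : 0 < y * (1 + 3 * w) := by positivity
  have hm0 : (0:ℝ) < m := by linarith
  -- the main lower bound
  have hmain : x + 0.6 * y ≤ m * (log m - c) := by
    have hlz : log (y * (1 + 3 * w)) = L - l + log (1 + 3 * w) := by
      rw [log_mul hy0.ne' (by positivity), hlogy]
    have hlw : 3 * w ≤ (1 + 3 * w) * log (1 + 3 * w) := by
      have := one_sub_inv_le_log_of_pos (x := 1 + 3 * w) (by positivity)
      calc 3 * w = (1 + 3 * w) * (1 - (1 + 3 * w)⁻¹) := by field_simp; ring
        _ ≤ _ := by gcongr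
    have hlw0 : 0 ≤ log (1 + 3 * w) := log_nonneg (by linarith)
    have hlm : log (y * (1 + 3 * w)) ≤ log m := log_le_log hz0 hm
    have hpos : 0 ≤ log (y * (1 + 3 * w)) - c := by rw [hlz]; norm_num at *; linarith
    have hA : y * (1 + 3 * w) * (log (y * (1 + 3 * w)) - c) ≤ m * (log m - c) := by
      apply mul_le_mul hm (by linarith) hpos hm0.le
    have hB : L + 0.6 ≤ (1 + 3 * w) * (L - l + log (1 + 3 * w) - c) := by
      have e : (1 + 3 * w) * (L - l + log (1 + 3 * w) - c) =
        L - l + 3 * (w * L) - 3 * (w * l) - c - 3 * w * c + (1 + 3 * w) * log (1 + 3 * w) := by ring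
      rw [e, hwL]
      have i1 : w * l ≤ 0.2817 * l := by gcongr
      have i2 : w * c ≤ w * 1.27 := by gcongr
      norm_num at *
      linarith
    calc x + 0.6 * y = y * (L + 0.6) := by rw [← hyL]; ring
      _ ≤ y * ((1 + 3 * w) * (L - l + log (1 + 3 * w) - c)) := by gcongr
      _ = y * (1 + 3 * w) * (log (y * (1 + 3 * w)) - c) := by rw [hlz]; ring
      _ ≤ _ := hA
  have hd : (0:ℝ) < padeD m := by exact_mod_cast padeD_pos m
  have hD : exp (m * (log 3 / 2)) ≤ 3 * (m + 1) * padeD m := by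
    have h := padeD_lower m
    apply le_of_sq_le_sq _ (by positivity)
    have e : exp (m * (log 3 / 2)) ^ 2 = 3 ^ m := by
      rw [← exp_nat_mul]
      have : ((2:ℕ):ℝ) * (m * (log 3 / 2)) = m * log 3 := by push_cast; ring
      rw [this, exp_nat_mul, exp_log (by norm_num)]
    rw [e]
    linarith
  have hF : exp (m * (log m - 1)) ≤ m.factorial := by
    have h := pow_div_factorial_le_exp (x := m) hm0.le m
    rw [div_le_iff₀ (by positivity)] at h
    have e : exp (m * (log m - 1)) = m ^ m / exp m := by
      rw [mul_sub, exp_sub, exp_nat_mul, exp_log hm0, mul_one]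
    rw [e, div_le_iff₀ (exp_pos _)]
    linarith
  have h94 : ((9:ℝ) / 4) ^ m = exp (m * (2 * log 3 - 2 * log 2)) := by
    rw [exp_nat_mul]
    congr 1
    rw [exp_sub, mul_comm 2, mul_comm 2, exp_mul, exp_mul, exp_log (by norm_num), exp_log (by norm_num)]
    norm_num
  have h64 : 18 * ((m:ℝ) + 1) ≤ exp (6 * log 2 + log y) := by
    have : exp (6 * log 2 + log y) = 64 * y := by
      rw [exp_add, exp_log hy0]
      have := exp_nat_mul (log 2) 6
      rw [exp_log (by norm_num)] at this
      push_cast at this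
      rw [this]; norm_num
    rw [this]; linarith
  have hprod : exp (m * (log m - 1)) * exp (m * (log 3 / 2)) ≤
      m.factorial * (3 * (m + 1) * padeD m) := by gcongr
  unfold padeR
  rw [← mul_div_assoc, div_le_one (by positivity)]
  have hfin : exp x * exp 3 * exp (m * (2 * log 3 - 2 * log 2)) * exp (6 * log 2 + log y) ≤
      exp (m * (log m - 1)) * exp (m * (log 3 / 2)) := by
    simp only [← exp_add]
    apply exp_le_exp.2
    have hly : log y ≤ y / 128 + 7 * log 2 - 1 := by
      have h6 := log_le_sub_one_of_pos (x := y / 128) (by positivity)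
      have : (128:ℝ) = 2 ^ 7 := by norm_num
      rw [log_div hy0.ne' (by norm_num)] at h6
      nth_rw 1 [this] at h6
      rw [log_pow] at h6
      push_cast at h6
      linarith
    have e : (m:ℝ) * (log m - c) = m * (log m - 1) + m * (log 3 / 2) - m * (2 * log 3 - 2 * log 2) := by
      rw [hc]; ring
    have := log_two_lt_d9
    norm_num at *
    linarith
  rw [h94]
  have hm1 : (0:ℝ) < 3 * (m + 1) := by positivity
  have key : exp x * exp 3 * exp (m * (2 * log 3 - 2 * log 2)) * (18 * ((m:ℝ) + 1)) ≤
      m.factorial * (3 * (m + 1) * padeD m) := by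
    refine le_trans ?_ (hfin.trans hprod)
    gcongr
  have key2 : (3 * ((m:ℝ) + 1)) * (6 * (exp x * exp 3 * exp (m * (2 * log 3 - 2 * log 2)))) ≤
      (3 * ((m:ℝ) + 1)) * (m.factorial * padeD m) := by linarith
  have := le_of_mul_le_mul_left key2 hm1
  linarith

lemma final_growth (x L l y w : ℝ) (hL : L = log x) (hl : l = log L) (hy : y = x / L)
    (hw : w = l / L) (hx : 983 ≤ x) : 22400 * y < exp (log 3 * (y * w)) := by
  obtain ⟨h1, h2, h3⟩ := num_facts x hx
  rw [← hL] at h1 h2 h3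
  rw [← hl] at h2 h3
  obtain ⟨hy0, hlogy, hy128, hyL⟩ := y_facts x L l y hL hl hy hx
  have hL0 : 0 < L := by linarith
  set u := y / L with hu
  have hu0 : 0 < u := by positivity
  have hlu : log u = L - 2 * l := by
    rw [hu, log_div hy0.ne' hL0.ne', hlogy, ← hl]; ring
  have hu2 : 16 ≤ u := by
    rw [← log_le_log_iff (by norm_num) hu0, hlu]
    have : (16:ℝ) = 2 ^ 4 := by norm_num
    rw [this, log_pow]
    have := log_two_lt_d9
    norm_num at *
    linarith
  have hlu2 : log u ≤ u / 16 + 4 * log 2 - 1 := by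
    have h6 := log_le_sub_one_of_pos (x := u / 16) (by positivity)
    have : (16:ℝ) = 2 ^ 4 := by norm_num
    rw [log_div hu0.ne' (by norm_num)] at h6
    nth_rw 1 [this] at h6
    rw [log_pow] at h6
    push_cast at h6
    linarith
  have hyw : y * w = u * l := by rw [hw, hu]; field_simp
  have hul : 1.9 * u ≤ u * l := by rw [mul_comm]; gcongr
  have h15 : 22400 * y ≤ exp (15 * log 2 + log y) := by
    rw [exp_add, exp_log hy0]
    have := exp_nat_mul (log 2) 15
    rw [exp_log (by norm_num)] at this
    push_cast at this
    rw [this]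
    gcongr
    norm_num
  refine h15.trans_lt (exp_lt_exp.2 ?_)
  rw [hyw, hlogy]
  have a1 := log_two_lt_d9
  have a2 := log_three_gt_d9
  have : 1 * (1.9 * u) ≤ log 3 * (u * l) := by
    have : 1 ≤ log 3 := by norm_num at *; linarith
    gcongr
  norm_num at *
  linarith

lemma main_pos (M N : ℤ) (hN : 0 < N) (x L l y w : ℝ) (hxN : x = log (N:ℝ)) (hL : L = log x)
    (hl : l = log L) (hy : y = x / L) (hw : w = l / L) (hx : 983 ≤ x) :
    1 < |exp 3 - (M : ℝ) / N| * 500 * (exp (2 * x + log 3 * (y * (1 + 4 * w)))) * y ^ 3 := by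
  obtain ⟨h1, h2, h3⟩ := num_facts x hx
  rw [← hL] at h1 h2 h3
  rw [← hl] at h2 h3
  obtain ⟨hy0, hlogy, hy128, hyL⟩ := y_facts x L l y hL hl hy hx
  have hL0 : 0 < L := by linarith
  have hw0 : 0 < w := by rw [hw]; exact div_pos (by linarith) hL0
  have hw1 : w ≤ 0.2817 := by rw [hw, div_le_iff₀ hL0]; exact h3
  have hN0 : (0:ℝ) < N := by exact_mod_cast hN
  have hN1 : (1:ℝ) ≤ N := by exact_mod_cast hN
  have hNx : (N:ℝ) = exp x := by rw [hxN, exp_log hN0]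
  have hyw : y * w ≤ 0.2817 * y := by rw [mul_comm]; gcongr
  have hz2 : y * (1 + 3 * w) + 2 ≤ 2 * y := by
    norm_num at *
    linarith
  set m0 := ⌈y * (1 + 3 * w)⌉₊ with hm0
  have hm0a : y * (1 + 3 * w) ≤ m0 := Nat.le_ceil _
  have hm0b : (m0 : ℝ) < y * (1 + 3 * w) + 1 := Nat.ceil_lt_add_one (by positivity)
  have hex : ∃ n : ℕ, 2 * (N:ℝ) * padeR n ≤ 1 := by
    refine ⟨m0, ?_⟩
    rw [hNx]
    exact padeR_small x L l y w hL hl hy hw hx m0 hm0a (by linarith)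
  classical
  set n := Nat.find hex with hn
  have hns : 2 * (N:ℝ) * padeR n ≤ 1 := Nat.find_spec hex
  have hnm : n ≤ m0 := Nat.find_min' hex (by
    rw [hNx]
    exact padeR_small x L l y w hL hl hy hw hx m0 hm0a (by linarith))
  have he : 1 < exp 3 := by rw [one_lt_exp_iff]; norm_num
  have hn2 : 2 ≤ n := by
    by_contra hcon
    have hR : 1 < padeR n := by
      have : n = 0 ∨ n = 1 := by omega
      rcases this with h | h <;> rw [h] <;> simp [padeR, padeD] <;> linarith
    nlinarith
  obtain ⟨k, hk⟩ : ∃ k, n = k + 1 := ⟨n - 1, by omega⟩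
  have hkmin : 1 < 2 * (N:ℝ) * padeR k := by
    have := Nat.find_min hex (m := k) (by omega)
    exact not_le.1 this
  have hkz : (k:ℝ) ≤ y * (1 + 3 * w) := by
    have : (k:ℝ) + 1 ≤ m0 := by exact_mod_cast (by omega : k + 1 ≤ m0)
    linarith
  obtain ⟨m, hm, hb⟩ := core_bound M N hN n hn2 hns
  have hpb := prod_bound k m (by omega)
  have hg := final_growth x L l y w hL hl hy hw hx
  have h3k : (3:ℝ) ^ k ≤ exp (log 3 * (y * (1 + 3 * w))) := by
    have : (3:ℝ) ^ k = exp (log 3 * k) := by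
      rw [mul_comm, exp_nat_mul, exp_log (by norm_num)]
    rw [this]
    apply exp_le_exp.2
    have : 0 < log 3 := log_pos (by norm_num)
    gcongr
  set E3 := exp (log 3 * (y * (1 + 3 * w))) with hE3
  have hE30 : 0 < E3 := exp_pos _
  have hE : exp (2 * x + log 3 * (y * (1 + 4 * w))) = N ^ 2 * (E3 * exp (log 3 * (y * w))) := by
    rw [hNx, ← exp_nat_mul, hE3, ← exp_add, ← exp_add]
    congr 1
    push_cast; ring
  have hpb2 : 2 * padeP m * (2 * padeR k) < 500 * (E3 * exp (log 3 * (y * w))) * y ^ 3 := by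
    calc 2 * padeP m * (2 * padeR k) ≤ 700000 * 3 ^ k * ((k:ℝ) + 2) ^ 4 := hpb
      _ ≤ 700000 * E3 * (2 * y) ^ 4 := by gcongr; linarith
      _ = 500 * (E3 * (22400 * y)) * y ^ 3 := by ring
      _ < _ := by gcongr
  have hP0 : 0 < padeP m := by
    have := padeD_pos m
    unfold padeP; positivity
  set δ := |exp 3 - (M:ℝ) / N| with hδ
  have hδ0 : 0 < δ := by
    have : 0 ≤ δ := abs_nonneg _
    rcases this.eq_or_lt with h | h
    · rw [← h] at hb; norm_num at hb
    · exact h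
  rw [hE]
  calc 1 ≤ 2 * padeP m * N * δ := hb
    _ = (2 * padeP m * N * δ) * 1 := by ring
    _ ≤ (2 * padeP m * N * δ) * (2 * N * padeR k) := by gcongr
    _ = (δ * N ^ 2) * (2 * padeP m * (2 * padeR k)) := by ring
    _ < (δ * N ^ 2) * (500 * (E3 * exp (log 3 * (y * w))) * y ^ 3) := by gcongr
    _ = _ := by ring


theorem rational_approx_exp_cube (M N : ℤ) (hM : M ≠ 0)
    (hN : Real.log (N : ℝ) ≥ 983) :
    1 < |Real.exp 3 - (M : ℝ) / (N : ℝ)| * 1561 *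
      (N : ℝ) ^ (2 + Real.log 3 * (1 + 4 * epsN (N : ℝ)) / Real.log (Real.log (N : ℝ))) *
      (Real.log (N : ℝ) / Real.log (Real.log (N : ℝ))) ^ 3 := by
  unfold epsN
  have hN0 : N ≠ 0 := by
    rintro rfl
    norm_num at hN
  set x := Real.log (N : ℝ) with hx
  set L := Real.log x with hL
  set l := Real.log L with hl
  set w := l / L with hw
  set y := x / L with hy
  obtain ⟨h1, h2, h3⟩ := num_facts x hN
  rw [← hL] at h1 h2 h3
  rw [← hl] at h2 h3
  obtain ⟨hy0, hlogy, hy128, hyL⟩ := y_facts x L l y hL hl hy hN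
  have hL0 : 0 < L := by linarith
  have hw0 : 0 < w := by rw [hw]; exact div_pos (by linarith) hL0
  have hw1 : w ≤ 0.2817 := by rw [hw, div_le_iff₀ hL0]; exact h3
  have hexp : x * (2 + Real.log 3 * (1 + 4 * w) / L) = 2 * x + Real.log 3 * (y * (1 + 4 * w)) := by
    rw [hy]; field_simp
  rcases lt_or_gt_of_ne hN0 with hneg | hpos
  · have hnegr : (N : ℝ) < 0 := by exact_mod_cast hneg
    have hmain := main_pos (-M) (-N) (by omega) x L l y w (by push_cast; rw [Real.log_neg_eq_log])
      hL hl hy hw hN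
    have e : (((-M : ℤ)) : ℝ) / ((-N : ℤ) : ℝ) = (M : ℝ) / N := by
      push_cast; rw [neg_div_neg_eq]
    rw [e] at hmain
    rw [Real.rpow_def_of_neg hnegr, ← hx, hexp]
    set θ := Real.log 3 * (1 + 4 * w) / L with hθ
    have hl3 := Real.log_three_lt_d9
    have hl3p : 0 < Real.log 3 := Real.log_pos (by norm_num)
    have hθ0 : 0 ≤ θ := by positivity
    have hθ1 : θ ≤ 0.35 := by
      rw [hθ, div_le_iff₀ hL0]
      calc Real.log 3 * (1 + 4 * w) ≤ 1.1 * (1 + 4 * 0.2817) := by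
            gcongr
            norm_num at *
            linarith
        _ ≤ 0.35 * 6.88 := by norm_num
        _ ≤ _ := by gcongr
    have hcos : 3 / 8 ≤ Real.cos ((2 + θ) * Real.pi) := by
      have e2 : (2 + θ) * Real.pi = θ * Real.pi + 2 * Real.pi := by ring
      rw [e2, Real.cos_add_two_pi]
      have h5 := Real.one_sub_sq_div_two_le_cos (x := θ * Real.pi)
      have h6 : θ * Real.pi ≤ 0.35 * 3.15 := by
        have := Real.pi_lt_d2
        gcongr
      have h7 : (θ * Real.pi) ^ 2 ≤ (0.35 * 3.15) ^ 2 := by gcongr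
      norm_num at *
      linarith
    set δ := |Real.exp 3 - (M : ℝ) / N|
    set E := Real.exp (2 * x + Real.log 3 * (y * (1 + 4 * w)))
    calc 1 < δ * 500 * E * y ^ 3 := hmain
      _ ≤ δ * 1561 * (E * (3 / 8)) * y ^ 3 := by
          have : 0 ≤ δ * E * y ^ 3 := by positivity
          linarith
      _ ≤ _ := by gcongr
  · have hposr : (0 : ℝ) < N := by exact_mod_cast hpos
    have hmain := main_pos M N hpos x L l y w hx hL hl hy hw hN
    rw [Real.rpow_def_of_pos hposr, ← hx, hexp]
    set δ := |Real.exp 3 - (M : ℝ) / N|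
    set E := Real.exp (2 * x + Real.log 3 * (y * (1 + 4 * w)))
    refine hmain.trans_le ?_
    have : 0 ≤ δ * E * y ^ 3 := by positivity
    linarith
end
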